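/- arXiv:1710.09477 — 2 statements merged into one kernel-verified Lean document; each statement's English description precedes it below -/
import Mathlib

section
/- Suppose k cakes are each divided into n pieces and there are p ≤ k(n−1)+1 hungry players with closed preferences, where for any division (a point of P(n,k) = (Δ_{n−1})^k) each player prefers a k-piece selection (one piece from each cake, each piece in the support of the corresponding cake's division). Then there exists a division of the k cakes such that at least ⌈p/(2k(k−1))⌉ players prefer mutually disjoint k-piece selections; if p divides k(n−1)+1, at least ⌈p/(k(k−1))⌉ players can be so satisfied. -/
open Finset


/-- degree of the vertex `(j,i)` under the weighting `w`. -/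
def hdeg {E : Type} [Fintype E] {k n : ℕ} (I : E → Fin k → Fin n) (w : E → ℝ)
    (j : Fin k) (i : Fin n) : ℝ := ∑ e, if I e j = i then w e else 0

lemma furedi_local {E : Type} [Fintype E] {k n : ℕ} (hk : 2 ≤ k)
    (I : E → Fin k → Fin n) (w : E → ℝ) (hw : ∀ e, 0 ≤ w e)
    (hd : ∀ j i, hdeg I w j i ≤ 1)
    (hker : ∀ z : E → ℝ, (∀ e, w e = 0 → z e = 0) →
      (∀ j i, hdeg I w j i = 1 → hdeg I z j i = 0) → z = 0)
    (hne : ∃ e, w e ≠ 0) :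
    ∃ e, w e ≠ 0 ∧ ∑ f, (if ∃ j, I f j = I e j then w f else 0) ≤ (k : ℝ) - 1 := by
  classical
  have hk1 : (0:ℝ) < (k:ℝ) - 1 := by
    have : (2:ℝ) ≤ k := by exact_mod_cast hk
    linarith
  -- it suffices to find an edge of weight at least 1/(k-1)
  suffices h : ∃ e, 1 ≤ ((k:ℝ) - 1) * w e by
    obtain ⟨e, he⟩ := h
    have he0 : w e ≠ 0 := by
      intro h0; rw [h0] at he; norm_num at he
    refine ⟨e, he0, ?_⟩
    have h1 : ∑ f, (if ∃ j, I f j = I e j then w f else 0) + ((k:ℝ) - 1) * w e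
        ≤ ∑ f, ∑ j, (if I f j = I e j then w f else 0) := by
      have h2 : ((k:ℝ) - 1) * w e = ∑ f, if f = e then ((k:ℝ) - 1) * w f else 0 := by simp
      rw [h2, ← Finset.sum_add_distrib]
      apply Finset.sum_le_sum
      intro f _
      by_cases hf : f = e
      · subst hf
        have : ∃ j : Fin k, I f j = I f j := ⟨⟨0, by omega⟩, rfl⟩
        rw [if_pos this, if_pos rfl]
        simp
        linarith
      · rw [if_neg hf, add_zero]
        split_ifs with h
        · obtain ⟨j, hj⟩ := h
          calc w f = if I f j = I e j then w f else 0 := by simp [hj]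
            _ ≤ _ := Finset.single_le_sum (f := fun j => if I f j = I e j then w f else 0)
                (fun j _ => by split_ifs; exact hw f; exact le_rfl) (Finset.mem_univ j)
        · exact Finset.sum_nonneg (fun j _ => by split_ifs; exact hw f; exact le_rfl)
    rw [Finset.sum_comm] at h1
    have h3 : ∑ j, ∑ f, (if I f j = I e j then w f else 0) ≤ ∑ j : Fin k, (1:ℝ) :=
      Finset.sum_le_sum (fun j _ => hd j (I e j))
    simp at h3
    linarith
  by_contra hcon
  push Not at hcon
  set P : Finset E := univ.filter (fun e => w e ≠ 0) with hP
  set T : Finset (Fin k × Fin n) := univ.filter (fun t => hdeg I w t.1 t.2 = 1) with hT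
  have hcount : ∀ t ∈ T, k ≤ (P.filter (fun e => I e t.1 = t.2)).card := by
    intro t ht
    by_contra hlt
    push Not at hlt
    have h1 : hdeg I w t.1 t.2 = 1 := by simpa [hT] using ht
    have h2 : hdeg I w t.1 t.2 = ∑ e ∈ P.filter (fun e => I e t.1 = t.2), w e := by
      unfold hdeg
      rw [← Finset.sum_filter]
      symm
      apply Finset.sum_subset_zero_on_sdiff
      · intro e; simp
      · intro e he
        simp [hP] at he
        by_contra h; exact he.2 h he.1
      · intros; rfl
    have hne' : (P.filter (fun e => I e t.1 = t.2)).Nonempty := by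
      by_contra h
      rw [Finset.not_nonempty_iff_eq_empty] at h
      rw [h] at h2; simp at h2; linarith
    have h3 : ((k:ℝ) - 1) * ∑ e ∈ P.filter (fun e => I e t.1 = t.2), w e
        < ∑ e ∈ P.filter (fun e => I e t.1 = t.2), (1:ℝ) := by
      rw [Finset.mul_sum]
      exact Finset.sum_lt_sum_of_nonempty hne' (fun e _ => hcon e)
    rw [← h2, h1] at h3
    simp at h3
    have : ((P.filter (fun e => I e t.1 = t.2)).card : ℝ) + 1 ≤ k := by exact_mod_cast hlt
    linarith
  -- double counting
  have hdc : ∑ t ∈ T, (P.filter (fun e => I e t.1 = t.2)).card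
      = ∑ e ∈ P, (univ.filter (fun j : Fin k => (j, I e j) ∈ T)).card := by
    simp_rw [Finset.card_filter]
    rw [Finset.sum_comm]
    apply Finset.sum_congr rfl
    intro e _
    rw [← Finset.card_filter, ← Finset.card_filter]
    symm
    apply Finset.card_bij (fun j _ => (j, I e j))
    · intro j hj; simpa using hj
    · intro a _ b _ h; exact (Prod.mk.inj h).1
    · rintro ⟨j, i⟩ h
      simp at h
      refine ⟨j, ?_, ?_⟩
      · simp [h.2, h.1]
      · simp [h.2]
  have hle1 : k * T.card ≤ ∑ t ∈ T, (P.filter (fun e => I e t.1 = t.2)).card := by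
    have := Finset.card_nsmul_le_sum T (fun t => (P.filter (fun e => I e t.1 = t.2)).card) k hcount
    simpa [mul_comm] using this
  have hle2' : ∀ e ∈ P, (univ.filter (fun j : Fin k => (j, I e j) ∈ T)).card ≤ k := by
    intro e _
    exact (Finset.card_le_univ _).trans (by simp)
  -- the linear map
  let A : (P → ℝ) →ₗ[ℝ] (T → ℝ) :=
    { toFun := fun z t => ∑ e : P, if I e t.1.1 = t.1.2 then z e else 0
      map_add' := by
        intro x y; ext t
        simp only [Pi.add_apply]
        rw [← Finset.sum_add_distrib]
        apply Finset.sum_congr rfl; intro e _; split_ifs <;> simp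
      map_smul' := by
        intro c x; ext t
        simp only [Pi.smul_apply, smul_eq_mul, RingHom.id_apply]
        rw [Finset.mul_sum]
        apply Finset.sum_congr rfl; intro e _; split_ifs <;> simp }
  have hA : ∀ z t, A z t = ∑ e : P, if I e t.1.1 = t.1.2 then z e else 0 := fun z t => rfl
  have hinj : Function.Injective A := by
    rw [← LinearMap.ker_eq_bot, LinearMap.ker_eq_bot']
    intro z hz
    have := hker (fun e => if h : e ∈ P then z ⟨e, h⟩ else 0) ?_ ?_
    · ext e
      have h2 := congrFun this e.1
      simpa using h2
    · intro e he
      have : e ∉ P := by simp [hP, he]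
      simp [this]
    · intro j i hji
      have ht : (j, i) ∈ T := by simp [hT, hji]
      have h2 := congrFun hz ⟨(j,i), ht⟩
      rw [hA] at h2
      unfold hdeg
      simp only [Pi.zero_apply] at h2
      refine Eq.trans ?_ h2
      rw [← Finset.sum_subset (Finset.subset_univ P)]
      · rw [← Finset.sum_coe_sort P]
        apply Finset.sum_congr rfl
        intro e _
        simp
      · intro e _ he; simp [he]
  have hcard : P.card ≤ T.card := by
    have := LinearMap.finrank_le_finrank_of_injective hinj
    simpa using this
  have hsum_le : ∑ e ∈ P, (univ.filter (fun j : Fin k => (j, I e j) ∈ T)).card ≤ ∑ e ∈ P, k :=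
    Finset.sum_le_sum hle2'
  have hPk : ∑ e ∈ P, k = k * P.card := by simp [mul_comm]
  have hTP : T.card ≤ P.card := by
    have : k * T.card ≤ k * P.card := by omega
    exact Nat.le_of_mul_le_mul_left this (by omega)
  have hceq : P.card = T.card := le_antisymm hcard hTP
  have hall : ∀ e ∈ P, (univ.filter (fun j : Fin k => (j, I e j) ∈ T)).card = k := by
    apply (Finset.sum_eq_sum_iff_of_le hle2').1
    apply le_antisymm hsum_le
    rw [hPk, hceq]; omega
  have hall' : ∀ e ∈ P, ∀ j, (j, I e j) ∈ T := by
    intro e he j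
    have h1 := hall e he
    have h2 : (univ.filter (fun j : Fin k => (j, I e j) ∈ T)) = univ := by
      apply Finset.eq_univ_of_card; simpa using h1
    have : j ∈ (univ.filter (fun j : Fin k => (j, I e j) ∈ T)) := by rw [h2]; simp
    simpa using this
  have hsurj : Function.Surjective A := by
    apply (LinearMap.injective_iff_surjective_of_finrank_eq_finrank (by simpa using hceq)).1 hinj
  obtain ⟨e0, he0⟩ := hne
  have he0P : e0 ∈ P := by simp [hP, he0]
  let j0 : Fin k := ⟨0, by omega⟩
  let j1 : Fin k := ⟨1, by omega⟩
  obtain ⟨z, hz⟩ := hsurj (fun t => if t.1 = (j0, I e0 j0) then 1 else 0)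
  have hs : ∀ j, ∑ t : T, (if t.1.1 = j then A z t else 0) = ∑ e : P, z e := by
    intro j
    simp_rw [hA]
    have : ∀ t : T, (if t.1.1 = j then ∑ e : P, (if I e t.1.1 = t.1.2 then z e else 0) else 0)
      = ∑ e : P, (if t = ⟨(j, I e j), hall' e e.2 j⟩ then z e else 0) := by
      intro t
      obtain ⟨⟨a, b⟩, ht⟩ := t
      simp only [Subtype.mk.injEq, Prod.mk.injEq]
      by_cases h : a = j
      · subst h
        simp only [if_true, true_and]
        apply Finset.sum_congr rfl; intro e _
        simp only [eq_comm]
      · simp [h]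
    simp_rw [this]
    rw [Finset.sum_comm]
    simp
  have h0 := hs j0
  have h1 := hs j1
  rw [hz] at h0 h1
  have e0' : ∑ t : T, (if t.1.1 = j0 then (if t.1 = (j0, I e0 j0) then (1:ℝ) else 0) else 0) = 1 := by
    rw [Finset.sum_eq_single (⟨(j0, I e0 j0), hall' e0 he0P j0⟩ : T)]
    · simp
    · intro t _ ht
      have : t.1 ≠ (j0, I e0 j0) := fun h => ht (Subtype.ext h)
      simp [this]
    · simp
  have e1' : ∑ t : T, (if t.1.1 = j1 then (if t.1 = (j0, I e0 j0) then (1:ℝ) else 0) else 0) = 0 := by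
    apply Finset.sum_eq_zero
    intro t _
    by_cases h : t.1 = (j0, I e0 j0)
    · have : t.1.1 ≠ j1 := by rw [h]; simp [j0, j1]
      simp [this]
    · simp [h]
  rw [e0'] at h0
  rw [e1'] at h1
  linarith

lemma hdeg_nonneg {E : Type} [Fintype E] {k n : ℕ} (I : E → Fin k → Fin n) (w : E → ℝ)
    (hw : ∀ e, 0 ≤ w e) (j i) : 0 ≤ hdeg I w j i :=
  Finset.sum_nonneg (fun e _ => by split_ifs; exact hw e; exact le_rfl)

lemma hdeg_comb {E : Type} [Fintype E] {k n : ℕ} (I : E → Fin k → Fin n) (w z : E → ℝ)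
    (a b : ℝ) (j i) : hdeg I (fun e => a * w e + b * z e) j i
      = a * hdeg I w j i + b * hdeg I z j i := by
  unfold hdeg
  rw [Finset.mul_sum, Finset.mul_sum, ← Finset.sum_add_distrib]
  apply Finset.sum_congr rfl; intro e _; split_ifs <;> simp

lemma hdeg_cont {E : Type} [Fintype E] {k n : ℕ} (I : E → Fin k → Fin n) (j i) :
    Continuous (fun w : E → ℝ => hdeg I w j i) := by
  unfold hdeg
  apply continuous_finsetSum
  intro e _
  split_ifs <;> fun_prop

lemma furedi_ext {E : Type} [Fintype E] {k n : ℕ} (hk : 2 ≤ k)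
    (I : E → Fin k → Fin n) (S : Finset E) (w0 : E → ℝ) (hw0 : ∀ e, 0 ≤ w0 e)
    (hS0 : ∀ e, e ∉ S → w0 e = 0) (hd0 : ∀ j i, hdeg I w0 j i ≤ 1) :
    ∃ w : E → ℝ, (∀ e, 0 ≤ w e) ∧ (∀ e, e ∉ S → w e = 0) ∧ (∀ j i, hdeg I w j i ≤ 1) ∧
      ∑ e, w0 e ≤ ∑ e, w e ∧
      (∀ z : E → ℝ, (∀ e, w e = 0 → z e = 0) →
      (∀ j i, hdeg I w j i = 1 → hdeg I z j i = 0) → z = 0) := by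
  classical
  let K : Set (E → ℝ) := {w | (∀ e, 0 ≤ w e) ∧ (∀ e, e ∉ S → w e = 0) ∧ (∀ j i, hdeg I w j i ≤ 1)}
  have hKc : IsCompact K := by
    apply IsCompact.of_isClosed_subset (isCompact_univ_pi (fun _ : E => isCompact_Icc (a := (0:ℝ)) (b := 1)))
    · have : K = (⋂ e, {w | 0 ≤ w e}) ∩ ((⋂ e, ⋂ (_ : e ∉ S), {w | w e = 0}) ∩
          (⋂ j, ⋂ i, {w | hdeg I w j i ≤ 1})) := by
        ext w; simp [K]
      rw [this]
      refine IsClosed.inter ?_ (IsClosed.inter ?_ ?_)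
      · exact isClosed_iInter (fun e => isClosed_le continuous_const (continuous_apply e))
      · exact isClosed_iInter (fun e => isClosed_iInter fun _ =>
          isClosed_eq (continuous_apply e) continuous_const)
      · exact isClosed_iInter (fun j => isClosed_iInter fun i =>
          isClosed_le (hdeg_cont I j i) continuous_const)
    · intro w hw e _
      refine ⟨hw.1 e, ?_⟩
      refine le_trans ?_ (hw.2.2 ⟨0, by omega⟩ (I e ⟨0, by omega⟩))
      unfold hdeg
      calc w e = if I e ⟨0, by omega⟩ = I e ⟨0, by omega⟩ then w e else 0 := by simp
        _ ≤ _ := Finset.single_le_sum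
          (f := fun f => if I f ⟨0, by omega⟩ = I e ⟨0, by omega⟩ then w f else 0)
          (fun f _ => by split_ifs; exact hw.1 f; exact le_rfl) (Finset.mem_univ e)
  let l : StrongDual ℝ (E → ℝ) := ∑ e, ContinuousLinearMap.proj e
  have hl : ∀ w, l w = ∑ e, w e := by intro w; simp [l]
  have hexp : IsExposed ℝ K (l.toExposed K) := ContinuousLinearMap.toExposed.isExposed
  have hne : (l.toExposed K).Nonempty := by
    obtain ⟨x, hx, hmax⟩ := hKc.exists_isMaxOn ⟨w0, hw0, hS0, hd0⟩ l.continuous.continuousOn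
    exact ⟨x, hx, fun y hy => hmax hy⟩
  obtain ⟨w, hw⟩ := (hexp.isCompact hKc).extremePoints_nonempty hne
  have hwext : w ∈ K.extremePoints ℝ := hexp.isExtreme.extremePoints_subset_extremePoints hw
  have hwmax := hw.1
  have hwK : w ∈ K := hwext.1
  refine ⟨w, hwK.1, hwK.2.1, hwK.2.2, ?_, ?_⟩
  · have := hwmax.2 w0 ⟨hw0, hS0, hd0⟩
    simpa [hl] using this
  · intro z hz hzt
    -- find a small eps
    have hev : ∀ᶠ t : ℝ in nhds 0, (fun e => 1 * w e + t * z e) ∈ K := by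
      have h1 : ∀ᶠ t : ℝ in nhds 0, ∀ e, 0 ≤ 1 * w e + t * z e := by
        rw [Filter.eventually_all]
        intro e
        by_cases h : w e = 0
        · simp [h, hz e h]
        · have hpos : 0 < 1 * w e + 0 * z e := by
            simpa using lt_of_le_of_ne (hwK.1 e) (Ne.symm h)
          have hc : Continuous (fun t : ℝ => 1 * w e + t * z e) := by fun_prop
          exact ((hc.tendsto 0).eventually (lt_mem_nhds hpos)).mono (fun t ht => le_of_lt ht)
      have h2 : ∀ᶠ t : ℝ in nhds 0, ∀ j i, 1 * hdeg I w j i + t * hdeg I z j i ≤ 1 := by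
        rw [Filter.eventually_all]
        intro j
        rw [Filter.eventually_all]
        intro i
        by_cases h : hdeg I w j i = 1
        · simp [h, hzt j i h]
        · have hlt : 1 * hdeg I w j i + 0 * hdeg I z j i < 1 := by
            simpa using lt_of_le_of_ne (hwK.2.2 j i) h
          have hc : Continuous (fun t : ℝ => 1 * hdeg I w j i + t * hdeg I z j i) := by fun_prop
          exact ((hc.tendsto 0).eventually (gt_mem_nhds hlt)).mono (fun t ht => le_of_lt ht)
      filter_upwards [h1, h2] with t ht1 ht2
      refine ⟨ht1, ?_, ?_⟩
      · intro e he
        have := hwK.2.1 e he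
        simp [this, hz e this]
      · intro j i
        rw [hdeg_comb]; exact ht2 j i
    obtain ⟨δ, hδ, hball⟩ := Metric.eventually_nhds_iff.1 hev
    have hp := @hball (δ/2) (by simp [abs_of_pos hδ]; linarith)
    have hm := @hball (-(δ/2)) (by simp [abs_of_pos hδ]; linarith)
    have := hwext.2 hp hm ⟨1/2, 1/2, by norm_num, by norm_num, by norm_num, by
      ext e; simp; ring⟩
    ext e
    have := congrFun this e
    simp at this
    rcases this with h | h
    · linarith
    · simpa using h

lemma furedi {E : Type} [Fintype E] [DecidableEq E] {k n : ℕ} (hk : 2 ≤ k)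
    (I : E → Fin k → Fin n) : ∀ (m : ℕ) (S : Finset E), S.card ≤ m → ∀ (w : E → ℝ),
    (∀ e, 0 ≤ w e) → (∀ e, e ∉ S → w e = 0) → (∀ j i, hdeg I w j i ≤ 1) →
    ∃ M : Finset E, M ⊆ S ∧ (M : Set E).Pairwise (fun e f => ∀ j, I e j ≠ I f j) ∧
      ∑ e, w e ≤ ((k : ℝ) - 1) * M.card := by
  intro m
  induction m with
  | zero =>
    intro S hS w hw hwS hd
    refine ⟨∅, by simp, by simp, ?_⟩
    have : S = ∅ := by simpa using hS
    subst this
    simp at hwS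
    simp [hwS]
  | succ m ih =>
    intro S hS w0 hw0 hwS0 hd0
    obtain ⟨w, hw, hwS, hd, hle, hker⟩ := furedi_ext hk I S w0 hw0 hwS0 hd0
    by_cases hne : ∃ e, w e ≠ 0
    · obtain ⟨e, he, hsum⟩ := furedi_local hk I w hw hd hker hne
      have heS : e ∈ S := by by_contra h; exact he (hwS e h)
      let S' := S.filter (fun f => ¬ ∃ j, I f j = I e j)
      have heS' : e ∉ S' := by
        simp [S']; intro _; exact ⟨⟨0, by omega⟩⟩
      have hlt : S'.card < S.card := Finset.card_lt_card
        ⟨Finset.filter_subset _ _, fun h => heS' (h heS)⟩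
      obtain ⟨M, hMS, hMp, hMc⟩ := ih S' (by omega)
        (fun f => if ∃ j, I f j = I e j then 0 else w f)
        (fun f => by split_ifs; exact le_rfl; exact hw f)
        (fun f hf => by
          by_cases h : ∃ j, I f j = I e j
          · simp [h]
          · rw [if_neg h]
            apply hwS; intro hfS; exact hf (by simp only [S', Finset.mem_filter]; exact ⟨hfS, h⟩))
        (fun j i => by
          refine le_trans ?_ (hd j i)
          apply Finset.sum_le_sum
          intro f _
          dsimp only
          split_ifs <;> first | exact le_rfl | exact hw f)
      have heM : e ∉ M := fun h => heS' (hMS h)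
      refine ⟨insert e M, ?_, ?_, ?_⟩
      · intro f hf
        rcases Finset.mem_insert.1 hf with rfl | h
        · exact heS
        · exact Finset.filter_subset _ _ (hMS h)
      · rw [Finset.coe_insert]
        refine hMp.insert ?_
        intro f hf _
        have := (Finset.mem_filter.1 (hMS hf)).2
        push Not at this
        exact ⟨fun j => (this j).symm, fun j => this j⟩
      · rw [Finset.card_insert_of_notMem heM]
        have h2 : ∑ f, w f = ∑ f, (if ∃ j, I f j = I e j then w f else 0)
            + ∑ f, (if ∃ j, I f j = I e j then 0 else w f) := by
          rw [← Finset.sum_add_distrib]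
          apply Finset.sum_congr rfl; intro f _; split_ifs <;> simp
        push_cast
        linarith
    · push Not at hne
      refine ⟨∅, by simp, by simp, ?_⟩
      simp [hne] at hle
      simpa using hle


/-- Elementary lattice steps of a cyclic Kuhn simplex. -/
def kstep {D : ℕ} (o : WithTop (Fin D)) (i : Fin D) : ℤ :=
  if o = ⊤ then -1 else if o = (i : WithTop (Fin D)) then 1 else 0

/-- Kuhn simplices, indexed cyclically by colour. -/
structure IsK {D : ℕ} (V : ZMod (D + 1) → Fin D → ℤ) : Prop where
  col : ∀ c, ((∑ i, V c i : ℤ) : ZMod (D + 1)) = c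
  ex : ∃ τ : ZMod (D + 1) → WithTop (Fin D), Function.Bijective τ ∧
    ∀ c i, V (c + 1) i = V c i + kstep (τ c) i

/-- Flip of a Kuhn simplex at the vertex of colour `c`. -/
def kflip {D : ℕ} (V : ZMod (D + 1) → Fin D → ℤ) (c : ZMod (D + 1)) :
    ZMod (D + 1) → Fin D → ℤ :=
  Function.update V c (fun i => V (c - 1) i + V (c + 1) i - V c i)

lemma kstep_inj {D : ℕ} : Function.Injective (kstep (D := D)) := by
  intro o o' h
  induction o using WithTop.recTopCoe with
  | top =>
    induction o' using WithTop.recTopCoe with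
    | top => rfl
    | coe a => have := congrFun h a; simp [kstep] at this
  | coe a =>
    have := congrFun h a
    induction o' using WithTop.recTopCoe with
    | top => simp [kstep] at this
    | coe b =>
      by_contra hne
      have h2 : b ≠ a := fun h => hne (by rw [h])
      simp [kstep, h2] at this

lemma zmod_one_ne {D : ℕ} (hD : 0 < D) : (1 : ZMod (D + 1)) ≠ 0 := by
  have : Fact (1 < D + 1) := ⟨by omega⟩
  exact one_ne_zero

lemma kflip_isK {D : ℕ} (hD : 0 < D) {V : ZMod (D + 1) → Fin D → ℤ} (hV : IsK V)
    (c : ZMod (D + 1)) : IsK (kflip V c) := by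
  have h1 := zmod_one_ne hD
  have hm : c - 1 ≠ c := by intro h; apply h1; simpa using h
  have hp : c + 1 ≠ c := by intro h; apply h1; simpa using h
  obtain ⟨hcol, τ, hτ, hst⟩ := hV
  have e1 : ∀ i, V c i = V (c - 1) i + kstep (τ (c - 1)) i := by
    intro i; have := hst (c - 1) i; rwa [sub_add_cancel] at this
  refine ⟨?_, τ ∘ Equiv.swap (c - 1) c, hτ.comp (Equiv.bijective _), ?_⟩
  · intro c'
    by_cases h : c' = c
    · subst h
      simp only [kflip, Function.update_self]
      rw [Finset.sum_sub_distrib, Finset.sum_add_distrib]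
      push_cast
      have a1 := hcol (c' - 1)
      have a2 := hcol (c' + 1)
      have a3 := hcol c'
      push_cast at a1 a2 a3
      rw [a1, a2, a3]; ring
    · simp only [kflip, Function.update_of_ne h]; exact hcol c'
  · intro c' i
    by_cases h : c' = c
    · subst h
      simp only [kflip, Function.update_self, Function.update_of_ne hp, Function.comp,
        Equiv.swap_apply_right]
      linarith [e1 i]
    · by_cases h' : c' = c - 1
      · subst h'
        simp only [kflip, sub_add_cancel, Function.update_self, Function.update_of_ne hm,
          Function.comp, Equiv.swap_apply_left]
        linarith [hst c i]
      · have h'' : c' + 1 ≠ c := by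
          intro h3; apply h'; rw [← h3]; ring
        simp only [kflip, Function.update_of_ne h, Function.update_of_ne h'', Function.comp,
          Equiv.swap_apply_of_ne_of_ne h' h]
        exact hst c' i

lemma kflip_kflip {D : ℕ} (hD : 0 < D) (V : ZMod (D + 1) → Fin D → ℤ)
    (c : ZMod (D + 1)) : kflip (kflip V c) c = V := by
  have h1 := zmod_one_ne hD
  have hm : c - 1 ≠ c := by intro h; apply h1; simpa using h
  have hp : c + 1 ≠ c := by intro h; apply h1; simpa using h
  funext c' i
  by_cases h : c' = c
  · subst h
    simp [kflip, Function.update_of_ne hm, Function.update_of_ne hp]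
  · simp [kflip, Function.update_of_ne h]

lemma kflip_ne {D : ℕ} (hD : 0 < D) {V : ZMod (D + 1) → Fin D → ℤ} (hV : IsK V)
    (c : ZMod (D + 1)) : kflip V c ≠ V := by
  have h1 := zmod_one_ne hD
  have hm : c - 1 ≠ c := by intro h; apply h1; simpa using h
  obtain ⟨hcol, τ, hτ, hst⟩ := hV
  intro h
  apply hm
  apply hτ.1
  apply kstep_inj
  funext i
  have h2 := congrFun (congrFun h c) i
  simp only [kflip, Function.update_self] at h2
  have e1 : V c i = V (c - 1) i + kstep (τ (c - 1)) i := by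
    have := hst (c - 1) i; rwa [sub_add_cancel] at this
  linarith [hst c i]

/-- combinatorial parity lemma -/
lemma door_parity {α β : Type} [Fintype α] [Fintype β] [DecidableEq α] [DecidableEq β]
    (hc : Fintype.card β = Fintype.card α + 1) (g : α → β) (a b : β) (hab : a ≠ b) :
    (∑ c : α, if (∀ o, o ≠ a → o ≠ b → ∃ c', c' ≠ c ∧ g c' = o) then (1 : ZMod 2) else 0)
      = (if (∀ o, o ≠ a → ∃ c', g c' = o) then 1 else 0)
        + (if (∀ o, o ≠ b → ∃ c', g c' = o) then 1 else 0) := by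
  classical
  have key : ∀ c, (∀ o, o ≠ a → o ≠ b → ∃ c', c' ≠ c ∧ g c' = o) →
      (∀ c', c' ≠ c → g c' ≠ a ∧ g c' ≠ b) ∧
      (∀ c1 c2, c1 ≠ c → c2 ≠ c → g c1 = g c2 → c1 = c2) := by
    intro c hgood
    have hsub : (univ.erase a).erase b ⊆ (univ.erase c).image g := by
      intro o ho
      simp at ho
      obtain ⟨c', h1, h2⟩ := hgood o ho.2 ho.1
      simp only [mem_image, mem_erase, mem_univ, and_true]
      exact ⟨c', h1, h2⟩
    have hcB : ((univ.erase a).erase b).card = Fintype.card α - 1 := by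
      rw [Finset.card_erase_of_mem (by simp [hab.symm]), Finset.card_erase_of_mem (by simp),
        Finset.card_univ]; omega
    have hcA : ((univ : Finset α).erase c).card = Fintype.card α - 1 := by
      rw [Finset.card_erase_of_mem (by simp), Finset.card_univ]
    have hle : ((univ.erase c).image g).card ≤ ((univ.erase a).erase b).card := by
      rw [hcB, ← hcA]; exact Finset.card_image_le
    have heq := Finset.eq_of_subset_of_card_le hsub hle
    constructor
    · intro c' hc'
      have : g c' ∈ (univ.erase a).erase b := by
        rw [heq]; exact Finset.mem_image_of_mem _ (by simp [hc'])
      simp at this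
      exact ⟨this.2, this.1⟩
    · have hinj : Set.InjOn g (univ.erase c : Finset α) := by
        apply Finset.card_image_iff.1
        rw [← heq, hcB, hcA]
      intro c1 c2 h1 h2 h
      exact hinj (by simp [h1]) (by simp [h2]) h
  have nosurj : ¬ ∀ o, ∃ c', g c' = o := by
    intro h
    have := Fintype.card_le_of_surjective g h
    omega
  by_cases hex : ∃ c, g c = a ∨ g c = b
  · obtain ⟨c, hcab⟩ := hex
    rw [Finset.sum_eq_single c]
    · rcases hcab with h | h
      · have hQ : ¬ ∀ o, o ≠ a → ∃ c', g c' = o := by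
          intro hq; apply nosurj; intro o
          by_cases ho : o = a
          · exact ⟨c, by rw [h, ho]⟩
          · exact hq o ho
        rw [if_neg hQ, zero_add]
        congr 1
        apply propext
        constructor
        · intro hg o ho
          by_cases hoa : o = a
          · exact ⟨c, by rw [h, hoa]⟩
          · obtain ⟨c', _, h'⟩ := hg o hoa ho; exact ⟨c', h'⟩
        · intro hg o ho1 ho2
          obtain ⟨c', h'⟩ := hg o ho2
          refine ⟨c', ?_, h'⟩
          rintro rfl; exact ho1 (by rw [← h', h])
      · have hQ : ¬ ∀ o, o ≠ b → ∃ c', g c' = o := by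
          intro hq; apply nosurj; intro o
          by_cases ho : o = b
          · exact ⟨c, by rw [h, ho]⟩
          · exact hq o ho
        rw [if_neg hQ, add_zero]
        congr 1
        apply propext
        constructor
        · intro hg o ho
          by_cases hoa : o = b
          · exact ⟨c, by rw [h, hoa]⟩
          · obtain ⟨c', _, h'⟩ := hg o ho hoa; exact ⟨c', h'⟩
        · intro hg o ho1 ho2
          obtain ⟨c', h'⟩ := hg o ho1
          refine ⟨c', ?_, h'⟩
          rintro rfl; exact ho2 (by rw [← h', h])
    · intro c' _ hne
      rw [if_neg]
      intro hg
      have := (key c' hg).1 c hne.symm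
      tauto
    · simp
  · push Not at hex
    have q1 : ¬ ∀ o, o ≠ a → ∃ c', g c' = o := by
      intro h; obtain ⟨c, hc⟩ := h b hab.symm; exact (hex c).2 hc
    have q2 : ¬ ∀ o, o ≠ b → ∃ c', g c' = o := by
      intro h; obtain ⟨c, hc⟩ := h a hab; exact (hex c).1 hc
    rw [if_neg q1, if_neg q2, add_zero]
    by_cases hgood : ∃ c, ∀ o, o ≠ a → o ≠ b → ∃ c', c' ≠ c ∧ g c' = o
    · obtain ⟨c1, h1⟩ := hgood
      obtain ⟨c2, h12, h2⟩ := h1 (g c1) (hex c1).1 (hex c1).2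
      have hg2 : ∀ o, o ≠ a → o ≠ b → ∃ c', c' ≠ c2 ∧ g c' = o := by
        intro o ho1 ho2
        obtain ⟨c', h', h''⟩ := h1 o ho1 ho2
        by_cases e : c' = c2
        · exact ⟨c1, h12.symm, by rw [← h2, ← e, h'']⟩
        · exact ⟨c', e, h''⟩
      rw [← Finset.sum_subset (Finset.subset_univ {c1, c2})]
      · rw [Finset.sum_pair h12.symm, if_pos h1, if_pos hg2]; decide
      · intro c _ hc
        rw [if_neg]
        intro hg
        simp at hc
        exact h12 ((key c hg).2 c2 c1 (fun h => hc.2 h.symm) (fun h => hc.1 h.symm) h2)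
    · push Not at hgood
      apply Finset.sum_eq_zero
      intro c _
      rw [if_neg]
      push Not
      exact hgood c

/-- rainbow simplices -/
def Rain {D : ℕ} (L : (Fin D → ℤ) → WithTop (Fin D)) : Set (ZMod (D + 1) → Fin D → ℤ) :=
  {V | IsK V ∧ Function.Surjective (fun c => L (V c))}

lemma star_finite {D : ℕ} (c0 : ZMod (D + 1)) (v : Fin D → ℤ) :
    {V : ZMod (D + 1) → Fin D → ℤ | IsK V ∧ V c0 = v}.Finite := by
  have hfin : (Set.univ.pi (fun _ : ZMod (D + 1) => Set.range (kstep (D := D)))).Finite :=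
    Set.Finite.pi' (fun _ => Set.finite_range _) |>.subset (by intro f hf i; exact hf i trivial)
  apply Set.Finite.of_finite_image (f := fun V => fun c => V (c + 1) - V c)
  · apply hfin.subset
    rintro _ ⟨V, ⟨hV, _⟩, rfl⟩ c _
    obtain ⟨τ, _, hst⟩ := hV.ex
    refine ⟨τ c, ?_⟩
    funext i
    simp [hst c i]
  · rintro V ⟨hV, h0⟩ V' ⟨hV', h0'⟩ h
    have hind : ∀ m : ℕ, V (c0 + m) = V' (c0 + m) := by
      intro m
      induction m with
      | zero => simp [h0, h0']
      | succ m ih =>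
        have := congrFun h (c0 + m)
        simp only at this
        rw [ih] at this
        have := sub_left_injective this
        push_cast
        rw [← add_assoc]; exact this
    funext c
    have := hind (c - c0).val
    rwa [ZMod.natCast_zmod_val, add_sub_cancel] at this

lemma star_parity {D : ℕ} (hD : 0 < D) (c0 : ZMod (D + 1)) (v : Fin D → ℤ)
    (L : (Fin D → ℤ) → WithTop (Fin D)) (a b : WithTop (Fin D)) :
    (({V : ZMod (D + 1) → Fin D → ℤ | (IsK V ∧ V c0 = v) ∧
        ∀ o, o ≠ a → ∃ c : {c // c ≠ c0}, L (V c) = o}.ncard : ℕ) : ZMod 2)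
    = ({V : ZMod (D + 1) → Fin D → ℤ | (IsK V ∧ V c0 = v) ∧
        ∀ o, o ≠ b → ∃ c : {c // c ≠ c0}, L (V c) = o}.ncard : ℕ) := by
  classical
  by_cases hab : a = b
  · rw [hab]
  set T := (star_finite c0 v).toFinset with hT
  have hmem : ∀ V, V ∈ T ↔ IsK V ∧ V c0 = v := by intro V; simp [hT]
  have hn : ∀ a, (({V : ZMod (D + 1) → Fin D → ℤ | (IsK V ∧ V c0 = v) ∧
        ∀ o, o ≠ a → ∃ c : {c // c ≠ c0}, L (V c) = o}.ncard : ℕ) : ZMod 2)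
      = ∑ V ∈ T, if (∀ o, o ≠ a → ∃ c : {c // c ≠ c0}, L (V c) = o) then (1 : ZMod 2) else 0 := by
    intro a
    rw [Finset.sum_boole]
    congr 1
    rw [← Set.ncard_coe_finset]
    congr 1
    ext V
    simp only [Finset.coe_filter, hmem, Set.mem_ofPred_eq]
  rw [hn a, hn b]
  have hcard : Fintype.card (WithTop (Fin D)) = Fintype.card {c : ZMod (D + 1) // c ≠ c0} + 1 := by
    rw [Fintype.card_subtype_compl, ZMod.card, Fintype.card_subtype_eq]
    have : Fintype.card (WithTop (Fin D)) = Fintype.card (Option (Fin D)) := rfl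
    rw [this]; simp
  have hsum : ∑ V ∈ T, ((if (∀ o, o ≠ a → ∃ c : {c // c ≠ c0}, L (V c) = o) then (1 : ZMod 2) else 0)
      + (if (∀ o, o ≠ b → ∃ c : {c // c ≠ c0}, L (V c) = o) then (1 : ZMod 2) else 0)) = 0 := by
    have : ∀ V ∈ T, ((if (∀ o, o ≠ a → ∃ c : {c // c ≠ c0}, L (V c) = o) then (1 : ZMod 2) else 0)
      + (if (∀ o, o ≠ b → ∃ c : {c // c ≠ c0}, L (V c) = o) then (1 : ZMod 2) else 0))
      = ∑ c : {c // c ≠ c0}, if (∀ o, o ≠ a → o ≠ b → ∃ c' : {c // c ≠ c0}, c' ≠ c ∧ L (V c') = o)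
        then (1 : ZMod 2) else 0 :=
      fun V _ => (door_parity hcard (fun c : {c // c ≠ c0} => L (V c)) a b hab).symm
    rw [Finset.sum_congr rfl this, ← Finset.sum_product']
    have hflip : ∀ (V : ZMod (D + 1) → Fin D → ℤ) (c : {c // c ≠ c0}) (c' : {c // c ≠ c0}),
        c' ≠ c → kflip V c c' = V c' := by
      intro V c c' h
      have : (c' : ZMod (D + 1)) ≠ c := fun h' => h (Subtype.ext h')
      simp [kflip, Function.update_of_ne this]
    refine Finset.sum_involution (fun (x : (ZMod (D + 1) → Fin D → ℤ) × {c // c ≠ c0}) _ =>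
      (kflip x.1 (x.2 : ZMod (D + 1)), x.2)) ?_ ?_ ?_ ?_
    · rintro ⟨V, c⟩ hx
      have : (∀ o, o ≠ a → o ≠ b → ∃ c' : {c // c ≠ c0}, c' ≠ c ∧ L (kflip V c c') = o) ↔
          (∀ o, o ≠ a → o ≠ b → ∃ c' : {c // c ≠ c0}, c' ≠ c ∧ L (V c') = o) := by
        refine forall_congr' fun o => imp_congr_right fun _ => imp_congr_right fun _ =>
          exists_congr fun c' => and_congr_right fun h => ?_
        rw [hflip V c c' h]
      simp only [this]
      split_ifs <;> decide
    · rintro ⟨V, c⟩ hx _ h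
      simp only [Finset.mem_product, hmem] at hx
      exact kflip_ne hD hx.1.1 c (Prod.mk.inj h).1
    · rintro ⟨V, c⟩ hx
      simp only [Finset.mem_product, hmem] at hx ⊢
      refine ⟨⟨kflip_isK hD hx.1.1 c, ?_⟩, by simp⟩
      rw [← hx.1.2]
      simp [kflip, Function.update_of_ne c.2.symm]
    · rintro ⟨V, c⟩ hx
      simp [kflip_kflip hD]
  rw [Finset.sum_add_distrib] at hsum
  have h2 : ∀ x y : ZMod 2, x + y = 0 → x = y := by decide
  exact h2 _ _ hsum

lemma rain_update {D : ℕ} (hD : 0 < D) (L L' : (Fin D → ℤ) → WithTop (Fin D)) (v : Fin D → ℤ)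
    (hLL : ∀ z, z ≠ v → L' z = L z) (hf : (Rain L).Finite) :
    (Rain L').Finite ∧ ((Rain L').ncard : ZMod 2) = (Rain L).ncard := by
  set c0 : ZMod (D + 1) := ((∑ i, v i : ℤ) : ZMod (D + 1)) with hc0
  set T := {V : ZMod (D + 1) → Fin D → ℤ | IsK V ∧ V c0 = v} with hT
  have hTf : T.Finite := star_finite c0 v
  have hne : ∀ V, IsK V → ∀ c, c ≠ c0 → V c ≠ v := by
    intro V hV c hc h
    apply hc
    rw [← hV.col c, h, hc0]
  have hoff : Rain L' \ T = Rain L \ T := by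
    ext V
    simp only [Rain, hT, Set.mem_sdiff, Set.mem_ofPred_eq]
    constructor
    · rintro ⟨⟨hV, hs⟩, hn⟩
      refine ⟨⟨hV, ?_⟩, hn⟩
      have : (fun c => L (V c)) = fun c => L' (V c) := by
        funext c
        rw [hLL]
        by_cases hc : c = c0
        · intro h; exact hn ⟨hV, hc ▸ h⟩
        · exact hne V hV c hc
      rw [this]; exact hs
    · rintro ⟨⟨hV, hs⟩, hn⟩
      refine ⟨⟨hV, ?_⟩, hn⟩
      have : (fun c => L' (V c)) = fun c => L (V c) := by
        funext c
        rw [hLL]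
        by_cases hc : c = c0
        · intro h; exact hn ⟨hV, hc ▸ h⟩
        · exact hne V hV c hc
      rw [this]; exact hs
  have hin : ∀ L'' : (Fin D → ℤ) → WithTop (Fin D), (∀ z, z ≠ v → L'' z = L z) →
      Rain L'' ∩ T = {V : ZMod (D + 1) → Fin D → ℤ | (IsK V ∧ V c0 = v) ∧
        ∀ o, o ≠ L'' v → ∃ c : {c // c ≠ c0}, L (V c) = o} := by
    intro L'' h''
    ext V
    simp only [Rain, hT, Set.mem_inter_iff, Set.mem_ofPred_eq]
    constructor
    · rintro ⟨⟨hV, hs⟩, hn⟩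
      refine ⟨hn, fun o ho => ?_⟩
      obtain ⟨c, hc⟩ := hs o
      have hcc : c ≠ c0 := by
        rintro rfl
        simp only [hn.2] at hc
        exact ho hc.symm
      refine ⟨⟨c, hcc⟩, ?_⟩
      rw [← h'' _ (hne V hV c hcc)]; exact hc
    · rintro ⟨hn, hs⟩
      refine ⟨⟨hn.1, fun o => ?_⟩, hn⟩
      by_cases ho : o = L'' v
      · refine ⟨c0, ?_⟩
        simp only [hn.2, ho]
      · obtain ⟨⟨c, hc⟩, h⟩ := hs o ho
        refine ⟨c, ?_⟩
        simp only
        rw [h'' _ (hne V hn.1 c hc)]; exact h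
  have hf' : (Rain L').Finite := by
    rw [← Set.inter_union_sdiff (Rain L') T, hoff]
    exact (hTf.subset Set.inter_subset_right).union (hf.subset Set.sdiff_subset)
  refine ⟨hf', ?_⟩
  rw [← Set.ncard_inter_add_ncard_sdiff_eq_ncard (Rain L') T hf',
    ← Set.ncard_inter_add_ncard_sdiff_eq_ncard (Rain L) T hf, hoff, hin L' hLL,
    hin L (fun _ _ => rfl)]
  push_cast
  rw [star_parity hD c0 v L (L' v) (L v)]


/-- the standard labelling -/
def L0 {D : ℕ} (z : Fin D → ℤ) : WithTop (Fin D) := (univ.filter (fun i => z i < 0)).min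

/-- the standard rainbow simplex -/
def V0 {D : ℕ} (c : ZMod (D + 1)) (i : Fin D) : ℤ := if i.val < (c - 1).val then 0 else -1

lemma L0_of {D : ℕ} (z : Fin D → ℤ) (m : Fin D) (h : ∀ i, z i < 0 → m ≤ i) (hm : z m < 0) :
    L0 z = m := by
  unfold L0
  apply le_antisymm
  · exact Finset.min_le (by simp [hm])
  · apply Finset.le_min
    intro a ha
    simp at ha
    exact_mod_cast h a ha

lemma L0_eq_top {D : ℕ} (z : Fin D → ℤ) : L0 z = ⊤ ↔ ∀ i, 0 ≤ z i := by
  unfold L0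
  rw [Finset.min_eq_top, Finset.filter_eq_empty_iff]
  simp

lemma L0_eq_coe {D : ℕ} (z : Fin D → ℤ) (i : Fin D) (h : L0 z = i) : z i < 0 := by
  have := Finset.mem_of_min h
  simpa using this

lemma zval {D m : ℕ} (hm : m ≤ D) : ((m : ZMod (D + 1))).val = m :=
  ZMod.val_natCast_of_lt (by omega)

lemma zexists {D : ℕ} (c d : ZMod (D + 1)) : ∃ m : ℕ, m ≤ D ∧ c = d + m := by
  refine ⟨(c - d).val, ?_, ?_⟩
  · have := ZMod.val_lt (c - d); omega
  · rw [ZMod.natCast_zmod_val]; ring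

lemma V0_apply {D m : ℕ} (hm : m ≤ D) (i : Fin D) :
    V0 (D := D) ((1 : ZMod (D + 1)) + (m : ZMod (D + 1))) i = if i.val < m then 0 else -1 := by
  unfold V0
  rw [add_sub_cancel_left, zval hm]

lemma L0_V0_lt {D m : ℕ} (hm : m < D) : L0 (V0 (D := D) ((1 : ZMod (D + 1)) + (m : ZMod (D + 1)))) = ((⟨m, hm⟩ : Fin D) : WithTop (Fin D)) := by
  apply L0_of
  · intro i hi
    rw [V0_apply hm.le] at hi
    split_ifs at hi with h
    · omega
    · rw [Fin.le_def]; simpa using h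
  · rw [V0_apply hm.le]; simp

lemma L0_V0_top {D : ℕ} : L0 (V0 (D := D) ((1 : ZMod (D + 1)) + ((D : ℕ) : ZMod (D + 1)))) = ⊤ := by
  rw [L0_eq_top]
  intro i
  rw [V0_apply le_rfl]; simp

lemma one_add_D {D : ℕ} : (1 : ZMod (D + 1)) + (D : ℕ) = 0 := by
  have := ZMod.natCast_self (D + 1)
  push_cast at this
  exact (add_comm _ _).trans this

lemma L0_V0_surj {D : ℕ} : Function.Surjective (fun c : ZMod (D + 1) => L0 (V0 c)) := by
  intro o
  induction o using WithTop.recTopCoe with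
  | top => exact ⟨_, L0_V0_top⟩
  | coe a => exact ⟨_, L0_V0_lt a.2⟩

lemma card_lab {D : ℕ} : Fintype.card (ZMod (D + 1)) = Fintype.card (WithTop (Fin D)) := by
  have : Fintype.card (WithTop (Fin D)) = Fintype.card (Option (Fin D)) := rfl
  rw [this, ZMod.card]; simp

lemma surj_bij {D : ℕ} (f : ZMod (D + 1) → WithTop (Fin D)) (h : Function.Surjective f) :
    Function.Bijective f :=
  (Fintype.bijective_iff_surjective_and_card f).2 ⟨h, card_lab⟩

lemma V0_isK {D : ℕ} : IsK (V0 (D := D)) := by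
  refine ⟨?_, fun c => L0 (V0 c), surj_bij _ L0_V0_surj, ?_⟩
  · intro c
    obtain ⟨m, hm, rfl⟩ := zexists c 1
    have : ∑ i : Fin D, V0 (D := D) ((1 : ZMod (D + 1)) + (m : ZMod (D + 1))) i = (m : ℤ) - D := by
      simp_rw [V0_apply hm]
      rw [Fin.sum_univ_eq_sum_range (fun i => if i < m then (0:ℤ) else -1) D]
      rw [Finset.sum_ite]
      simp
      have : (range D).filter (fun x => m ≤ x) = Finset.Ico m D := by
        ext x; simp; omega
      rw [this, Nat.card_Ico]
      omega
    rw [this]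
    push_cast
    have := one_add_D (D := D)
    linear_combination -this
  · intro c i
    obtain ⟨m, hm, rfl⟩ := zexists c 1
    dsimp only
    rcases hm.lt_or_eq with h | h
    · rw [L0_V0_lt h]
      have : (1 : ZMod (D + 1)) + m + 1 = 1 + ((m + 1 : ℕ) : ZMod (D + 1)) := by push_cast; ring
      rw [this, V0_apply hm, V0_apply (by omega : m + 1 ≤ D)]
      simp only [kstep, WithTop.coe_ne_top, if_false, WithTop.coe_inj, Fin.ext_iff]
      split_ifs <;> omega
    · subst h
      rw [L0_V0_top, V0_apply le_rfl, one_add_D]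
      have : (0 : ZMod (m + 1)) + 1 = 1 + ((0 : ℕ) : ZMod (m + 1)) := by simp
      rw [this, V0_apply (by omega)]
      simp [kstep]

lemma rain_L0 {D : ℕ} (hD : 0 < D) : Rain (L0 (D := D)) = {V0} := by
  ext V
  rw [Set.mem_singleton_iff]
  constructor
  · rintro ⟨hV, hs⟩
    have hinj := (surj_bij _ hs).1
    obtain ⟨hcol, τ, hτ, hst⟩ := hV
    obtain ⟨c, hc⟩ := hτ.2 ⊤
    have hnt : ∀ j : ℕ, j < D → τ (c + 1 + j) ≠ ⊤ := by
      intro j hj h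
      have := hτ.1 (h.trans hc.symm)
      have h2 : ((j + 1 : ℕ) : ZMod (D + 1)) = 0 := by
        push_cast; linear_combination this
      have h3 := zval (D := D) (m := j + 1) (by omega)
      rw [h2] at h3; simp at h3
    have hstep : ∀ o : WithTop (Fin D), o ≠ ⊤ → ∀ i, 0 ≤ kstep o i := by
      intro o ho i; simp only [kstep, if_neg ho]; split_ifs <;> omega
    have hsucc : ∀ j : ℕ, j < D → ∀ i, V (c + 1 + j) i ≤ V (c + 1 + (j + 1 : ℕ)) i := by
      intro j hj i
      have h1 := hst (c + 1 + j) i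
      have h2 := hstep _ (hnt j hj) i
      have : c + 1 + ((j + 1 : ℕ) : ZMod (D + 1)) = c + 1 + j + 1 := by push_cast; ring
      rw [this]; omega
    have hmono : ∀ m t : ℕ, m + t ≤ D → ∀ i, V (c + 1 + m) i ≤ V (c + 1 + (m + t : ℕ)) i := by
      intro m t
      induction t with
      | zero => intro _ i; simp
      | succ t ih => intro h i; exact (ih (by omega) i).trans (hsucc (m + t) (by omega) i)
    have hcD : c + 1 + (D : ℕ) = c := by
      rw [add_assoc, one_add_D, add_zero]
    have hmin : ∀ c' i, V (c + 1) i ≤ V c' i := by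
      intro c' i
      obtain ⟨m, hm, rfl⟩ := zexists c' (c + 1)
      have := hmono 0 m (by omega) i
      simpa using this
    have hmax : ∀ c' i, V c' i ≤ V c i := by
      intro c' i
      obtain ⟨m, hm, rfl⟩ := zexists c' (c + 1)
      have := hmono m (D - m) (by omega) i
      rw [show m + (D - m) = D by omega, hcD] at this
      exact this
    have hc1 : ∀ i, V (c + 1) i = V c i - 1 := by
      intro i; rw [hst c i, hc]; simp [kstep]; ring
    have h0 : ∀ i, V c i = 0 := by
      intro i
      obtain ⟨c1, h1⟩ := hs ⊤
      have h1' := (L0_eq_top _).1 h1 i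
      obtain ⟨c2, h2⟩ := hs i
      have h2' := L0_eq_coe _ _ h2
      have := hmin c2 i
      have := hmax c1 i
      have := hc1 i
      omega
    have hc0 : c = 0 := by
      have := hcol c
      simp [h0] at this
      exact this.symm
    subst hc0
    simp only [zero_add] at *
    have hind : ∀ m : ℕ, m ≤ D → V (1 + m) = V0 (1 + m) := by
      intro m
      induction m with
      | zero =>
        intro h
        funext i
        rw [V0_apply h]
        simp [hc1, h0]
      | succ m ih =>
        intro h
        have ih := ih (by omega)
        have hm : m < D := by omega
        have he : (1 : ZMod (D + 1)) + ((m + 1 : ℕ) : ZMod (D + 1)) = 1 + m + 1 := by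
          push_cast; ring
        obtain ⟨a, ha⟩ := WithTop.ne_top_iff_exists.1 (hnt m hm)
        have hv : ∀ i, V (1 + ((m + 1 : ℕ) : ZMod (D + 1))) i
            = (if i.val < m then 0 else -1) + if a = i then 1 else 0 := by
          intro i
          rw [he, hst, ih, V0_apply hm.le, ← ha]
          simp [kstep]
        have ham : m ≤ a.val := by
          by_contra hlt
          have h1 := hmax (1 + ((m + 1 : ℕ) : ZMod (D + 1))) a
          rw [hv, h0] at h1
          simp at h1
          split_ifs at h1 <;> omega
        have haeq : a.val = m := by
          by_contra hne
          have hlab : L0 (V (1 + ((m + 1 : ℕ) : ZMod (D + 1)))) = ((⟨m, hm⟩ : Fin D) : WithTop (Fin D)) := by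
            apply L0_of
            · intro i hi
              rw [hv] at hi
              rw [Fin.le_def]
              by_contra hh
              simp at hh
              simp [hh] at hi
              split_ifs at hi <;> omega
            · rw [hv]
              have : a ≠ ⟨m, hm⟩ := by intro h; apply hne; rw [h]
              simp [this]
          have hlab2 : L0 (V (1 + (m : ZMod (D + 1)))) = ((⟨m, hm⟩ : Fin D) : WithTop (Fin D)) := by
            rw [ih]; exact L0_V0_lt hm
          have h3 := hinj (hlab.trans hlab2.symm)
          rw [he] at h3
          exact zmod_one_ne hD (by simpa using h3)
        funext i
        rw [hv, V0_apply h]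
        have : a = i ↔ i.val = m := by rw [Fin.ext_iff, haeq]; exact eq_comm
        simp only [this]
        split_ifs <;> omega
    funext c'
    obtain ⟨m, hm, rfl⟩ := zexists c' 1
    exact hind m hm
  · rintro rfl
    exact ⟨V0_isK, L0_V0_surj⟩

lemma rain_odd {D : ℕ} (hD : 0 < D) (F : Finset (Fin D → ℤ)) :
    ∀ L : (Fin D → ℤ) → WithTop (Fin D), (∀ z, z ∉ F → L z = L0 z) →
      (Rain L).Finite ∧ ((Rain L).ncard : ZMod 2) = 1 := by
  classical
  induction F using Finset.induction_on with
  | empty =>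
    intro L hL
    have : L = L0 := funext fun z => hL z (by simp)
    rw [this, rain_L0 hD]
    simp
  | insert v F hv ih =>
    intro L hL
    obtain ⟨h1, h2⟩ := ih (Function.update L v (L0 v)) (by
      intro z hz
      by_cases h : z = v
      · subst h; simp
      · rw [Function.update_of_ne h]; exact hL z (by simp [h, hz]))
    obtain ⟨h3, h4⟩ := rain_update hD _ L v
      (fun z hz => (Function.update_of_ne hz (L0 v) L).symm) h1
    exact ⟨h3, h4.trans h2⟩

lemma rain_nonempty {D : ℕ} (hD : 0 < D) (F : Finset (Fin D → ℤ))
    (L : (Fin D → ℤ) → WithTop (Fin D)) (hL : ∀ z, z ∉ F → L z = L0 z) : (Rain L).Nonempty := by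
  by_contra h
  rw [Set.not_nonempty_iff_eq_empty] at h
  have := (rain_odd hD F L hL).2
  rw [h] at this
  simp at this

lemma isK_close {D : ℕ} {V : ZMod (D + 1) → Fin D → ℤ} (hV : IsK V) (c d : ZMod (D + 1))
    (i : Fin D) : |V c i - V d i| ≤ D := by
  obtain ⟨hcol, τ, hτ, hst⟩ := hV
  obtain ⟨m, hm, rfl⟩ := zexists c d
  have : ∀ m : ℕ, |V (d + m) i - V d i| ≤ m := by
    intro m
    induction m with
    | zero => simp
    | succ m ih =>
      have h1 : |kstep (τ (d + m)) i| ≤ 1 := by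
        unfold kstep; split_ifs <;> simp
      have : d + ((m + 1 : ℕ) : ZMod (D + 1)) = d + m + 1 := by push_cast; ring
      rw [this, hst]
      rw [abs_le] at *
      push_cast
      constructor <;> linarith
  exact (this m).trans (by exact_mod_cast hm)

/-- Fixed points for maps of compact support. -/
lemma brouwer_supp {D : ℕ} (hD : 0 < D) (H : (Fin D → ℝ) → (Fin D → ℝ)) (hc : Continuous H)
    (h01 : ∀ x i, 0 ≤ H x i ∧ H x i ≤ 1) (hs : ∀ x, 2 ≤ ‖x‖ → H x = 0) : ∃ x, H x = x := by
  classical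
  have key : ∀ M : ℕ, ∃ (x : Fin D → ℝ) (y : Fin D → Fin D → ℝ),
      (∀ i, H x i ≤ x i) ∧ (∀ i, y i i ≤ H (y i) i) ∧
      ∀ i j, |y i j - x j| ≤ D / ((M : ℝ) + 1) := by
    intro M
    have hM : (0:ℝ) < (M:ℝ) + 1 := by positivity
    let sc : (Fin D → ℤ) → (Fin D → ℝ) := fun z i => (z i : ℝ) / ((M:ℝ) + 1)
    let L : (Fin D → ℤ) → WithTop (Fin D) := fun z => (univ.filter (fun i => sc z i < H (sc z) i)).min
    let B : ℤ := 2 * (M + 1)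
    obtain ⟨V, hV, hsurj⟩ := rain_nonempty hD (Fintype.piFinset (fun _ => Finset.Icc (-B) B)) L (by
      intro z hz
      have hex : ∃ i, B < |z i| := by
        by_contra hcon
        push Not at hcon
        apply hz
        rw [Fintype.mem_piFinset]
        intro i
        rw [Finset.mem_Icc]
        exact abs_le.1 (hcon i)
      obtain ⟨i, hi⟩ := hex
      have hn : 2 ≤ ‖sc z‖ := by
        refine le_trans ?_ (norm_le_pi_norm (sc z) i)
        simp only [sc, Real.norm_eq_abs]
        rw [abs_div, abs_of_pos hM, le_div_iff₀ hM]
        have : (B:ℝ) ≤ |(z i : ℝ)| := by exact_mod_cast hi.le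
        simpa [B] using this
      simp only [L, L0, hs _ hn]
      congr 1
      ext j
      simp only [Finset.mem_filter, Finset.mem_univ, true_and, Pi.zero_apply, sc]
      rw [div_lt_iff₀ hM]
      simp)
    obtain ⟨c, hct⟩ := hsurj ⊤
    choose d hd using fun i : Fin D => hsurj (i : WithTop (Fin D))
    refine ⟨sc (V c), fun i => sc (V (d i)), ?_, ?_, ?_⟩
    · intro i
      have := Finset.filter_eq_empty_iff.1 (Finset.min_eq_top.1 hct) (Finset.mem_univ i)
      exact not_lt.1 this
    · intro i
      have := Finset.mem_of_min (hd i)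
      exact le_of_lt (Finset.mem_filter.1 this).2
    · intro i j
      simp only [sc]
      rw [← sub_div, abs_div, abs_of_pos hM]
      apply div_le_div_of_nonneg_right _ hM.le
      exact_mod_cast isK_close hV (d i) c j
  choose x y hx hy hxy using key
  have hbd : ∀ M, x M ∈ Set.Icc (0 : Fin D → ℝ) (fun _ => (D:ℝ) + 1) := by
    intro M
    constructor
    · intro i; exact (h01 (x M) i).1.trans (hx M i)
    · intro i
      have h1 := (hy M i).trans (h01 _ i).2
      have h2 := abs_le.1 (hxy M i i)
      have h3 : (D:ℝ) / ((M:ℝ) + 1) ≤ D := div_le_self (by positivity) (by simp)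
      dsimp only
      linarith [h2.1]
  obtain ⟨x0, _, φ, hφ, hlim⟩ := isCompact_Icc.tendsto_subseq hbd
  have hlimj : ∀ j, Filter.Tendsto (fun t => x (φ t) j) Filter.atTop (nhds (x0 j)) :=
    fun j => (tendsto_pi_nhds.1 hlim) j
  have hz : Filter.Tendsto (fun t => (D:ℝ) / ((φ t : ℝ) + 1)) Filter.atTop (nhds 0) := by
    have h1 : Filter.Tendsto (fun t : ℕ => (D:ℝ) / ((t : ℝ) + 1)) Filter.atTop (nhds 0) := by
      apply Filter.Tendsto.const_div_atTop
      exact Filter.tendsto_atTop_add_const_right _ _ tendsto_natCast_atTop_atTop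
    exact h1.comp hφ.tendsto_atTop
  have hylim : ∀ i, Filter.Tendsto (fun t => y (φ t) i) Filter.atTop (nhds x0) := by
    intro i
    rw [tendsto_pi_nhds]
    intro j
    have h0 : Filter.Tendsto (fun t => y (φ t) i j - x (φ t) j) Filter.atTop (nhds 0) :=
      squeeze_zero_norm (fun t => hxy (φ t) i j) hz
    have := h0.add (hlimj j)
    simpa using this
  refine ⟨x0, ?_⟩
  funext i
  have hci : Continuous (fun x => H x i) := (continuous_apply i).comp hc
  apply le_antisymm
  · exact le_of_tendsto_of_tendsto' ((hci.tendsto x0).comp hlim) (hlimj i) (fun t => hx (φ t) i)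
  · exact le_of_tendsto_of_tendsto' (tendsto_pi_nhds.1 (hylim i) i) ((hci.tendsto x0).comp (hylim i))
      (fun t => hy (φ t) i)

lemma brouwer_fin {D : ℕ} (G : (Fin D → ℝ) → (Fin D → ℝ)) (hc : Continuous G)
    (h01 : ∀ x i, 0 ≤ G x i ∧ G x i ≤ 1) : ∃ x, G x = x := by
  rcases Nat.eq_zero_or_pos D with h | hD
  · subst h; exact ⟨0, Subsingleton.elim _ _⟩
  let χ : (Fin D → ℝ) → ℝ := fun x => max 0 (min 1 (2 - ‖x‖))
  have hχ0 : ∀ x, 0 ≤ χ x := fun x => le_max_left _ _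
  have hχ1 : ∀ x, χ x ≤ 1 := fun x => max_le (by norm_num) (min_le_left _ _)
  have hχc : Continuous χ := by fun_prop
  obtain ⟨x, hx⟩ := brouwer_supp hD (fun x i => χ x * G x i) (by fun_prop)
    (fun x i => ⟨mul_nonneg (hχ0 x) (h01 x i).1, mul_le_one₀ (hχ1 x) (h01 x i).1 (h01 x i).2⟩)
    (fun x hx => by
      have : χ x = 0 := by
        apply max_eq_left
        exact (min_le_right _ _).trans (by linarith)
      funext i; simp [this])
  refine ⟨x, ?_⟩
  have hn : ‖x‖ ≤ 1 := by
    rw [pi_norm_le_iff_of_nonneg (by norm_num)]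
    intro i
    rw [← hx, Real.norm_eq_abs, abs_of_nonneg (mul_nonneg (hχ0 x) (h01 x i).1)]
    exact mul_le_one₀ (hχ1 x) (h01 x i).1 (h01 x i).2
  have h1 : χ x = 1 := by
    have : min 1 (2 - ‖x‖) = 1 := min_eq_left (by linarith)
    simp only [χ, this]; norm_num
  conv_rhs => rw [← hx]
  funext i
  simp [h1]

lemma brouwer_prod {k n : ℕ} (G : (Fin k → Fin n → ℝ) → (Fin k → Fin n → ℝ)) (hc : Continuous G)
    (h01 : ∀ x j i, 0 ≤ G x j i ∧ G x j i ≤ 1) : ∃ x, G x = x := by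
  let e : (Fin (k * n) → ℝ) → (Fin k → Fin n → ℝ) := fun u j i => u (finProdFinEquiv (j, i))
  let e' : (Fin k → Fin n → ℝ) → (Fin (k * n) → ℝ) :=
    fun x t => x (finProdFinEquiv.symm t).1 (finProdFinEquiv.symm t).2
  have hee : ∀ x, e (e' x) = x := by intro x; funext j i; simp only [e, e', Equiv.symm_apply_apply]
  obtain ⟨u, hu⟩ := brouwer_fin (fun u => e' (G (e u))) (by
      have h1 : Continuous e := by fun_prop
      have h2 : Continuous e' := by fun_prop
      exact h2.comp (hc.comp h1)) (fun u t => h01 _ _ _)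
  refine ⟨e u, ?_⟩
  conv_rhs => rw [← hu]
  rw [hee]


/-- the space of divisions -/
def cakeP (k n : ℕ) : Set (Fin k → Fin n → ℝ) := {x | ∀ j, x j ∈ stdSimplex ℝ (Fin n)}

/-- A retraction to the space of divisions. -/
noncomputable def cakeR {k n : ℕ} (x : Fin k → Fin n → ℝ) (j : Fin k) (i : Fin n) : ℝ :=
  (max (x j i) 0 + max 0 (1 - ∑ i', max (x j i') 0) / n) / max (∑ i', max (x j i') 0) 1

lemma cakeR_cont {k n : ℕ} : Continuous (cakeR (k := k) (n := n)) := by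
  unfold cakeR
  refine continuous_pi fun j => continuous_pi fun i => ?_
  apply Continuous.div
  · fun_prop
  · fun_prop
  · intro x
    have : (1:ℝ) ≤ max (∑ i', max (x j i') 0) 1 := le_max_right _ _
    linarith

lemma cakeR_mem {k n : ℕ} (hn : 0 < n) (x : Fin k → Fin n → ℝ) : cakeR x ∈ cakeP k n := by
  intro j
  have hn' : (0:ℝ) < n := by exact_mod_cast hn
  have h1 : (1:ℝ) ≤ max (∑ i', max (x j i') 0) 1 := le_max_right _ _
  refine ⟨fun i => ?_, ?_⟩
  · unfold cakeR
    have := le_max_right (x j i) 0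
    have := le_max_left 0 (1 - ∑ i', max (x j i') 0)
    positivity
  · unfold cakeR
    rw [← Finset.sum_div, Finset.sum_add_distrib, div_eq_one_iff_eq (by linarith)]
    simp only [Finset.sum_const, Finset.card_univ, Fintype.card_fin, nsmul_eq_mul]
    rw [mul_div_cancel₀ _ hn'.ne']
    rcases le_total (∑ i', max (x j i') 0) 1 with h | h
    · rw [max_eq_right h, max_eq_right (by linarith)]; ring
    · rw [max_eq_left h, max_eq_left (by linarith)]; ring

lemma cakeR_id {k n : ℕ} (x : Fin k → Fin n → ℝ) (hx : x ∈ cakeP k n) : cakeR x = x := by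
  funext j i
  have h0 : ∀ i, max (x j i) 0 = x j i := fun i => max_eq_left ((hx j).1 i)
  have hs : ∑ i, x j i = 1 := (hx j).2
  unfold cakeR
  simp [h0, hs]

/-- face-preserving maps hit the barycenter -/
lemma hit_bary {k n : ℕ} (hn : 0 < n) (f : (Fin k → Fin n → ℝ) → (Fin k → Fin n → ℝ))
    (hf : ContinuousOn f (cakeP k n)) (hs : ∀ x ∈ cakeP k n, ∀ j, ∑ i, f x j i = 1)
    (h0 : ∀ x ∈ cakeP k n, ∀ j i, x j i = 0 → f x j i = 0) :
    ∃ x ∈ cakeP k n, ∀ j i, f x j i = 1 / n := by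
  have hn' : (0:ℝ) < n := by exact_mod_cast hn
  have hfr : Continuous (fun x => f (cakeR x)) :=
    hf.comp_continuous cakeR_cont (cakeR_mem hn)
  let h : (Fin k → Fin n → ℝ) → Fin k → Fin n → ℝ := fun x j i => max 0 (1 / n - f (cakeR x) j i)
  have hh0 : ∀ x j i, 0 ≤ h x j i := fun x j i => le_max_left _ _
  have hhc : ∀ j i, Continuous (fun x => h x j i) := by
    intro j i
    have : Continuous (fun x => f (cakeR x) j i) :=
      (continuous_apply i).comp ((continuous_apply j).comp hfr)
    exact continuous_const.max (continuous_const.sub this)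
  have hden : ∀ x j, 0 < 1 + ∑ i, h x j i := fun x j => by
    have := Finset.sum_nonneg (fun i (_ : i ∈ univ) => hh0 x j i); linarith
  let G : (Fin k → Fin n → ℝ) → Fin k → Fin n → ℝ :=
    fun x j i => (cakeR x j i + h x j i) / (1 + ∑ i, h x j i)
  have hGP : ∀ x, G x ∈ cakeP k n := by
    intro x j
    refine ⟨fun i => ?_, ?_⟩
    · exact div_nonneg (add_nonneg ((cakeR_mem hn x j).1 i) (hh0 x j i)) (hden x j).le
    · simp only [G]
      rw [← Finset.sum_div, Finset.sum_add_distrib, (cakeR_mem hn x j).2, div_self (hden x j).ne']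
  obtain ⟨x, hx⟩ := brouwer_prod G (by
      refine continuous_pi fun j => continuous_pi fun i => ?_
      apply Continuous.div
      · exact ((continuous_apply i).comp ((continuous_apply j).comp cakeR_cont)).add (hhc j i)
      · exact continuous_const.add (continuous_finsetSum _ (fun i _ => hhc j i))
      · intro x; exact (hden x j).ne')
    (fun x j i => ⟨(hGP x j).1 i, by
      rw [← (hGP x j).2]
      exact Finset.single_le_sum (fun i _ => (hGP x j).1 i) (Finset.mem_univ i)⟩)
  have hxP : x ∈ cakeP k n := hx ▸ hGP x
  have hr := cakeR_id x hxP
  refine ⟨x, hxP, fun j => ?_⟩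
  have hfix : ∀ i, h x j i = x j i * ∑ i, h x j i := by
    intro i
    have h1 : G x j i = x j i := by rw [hx]
    simp only [G] at h1
    rw [div_eq_iff (hden x j).ne', hr] at h1
    linarith
  have hH : ∑ i, h x j i = 0 := by
    by_contra hne
    have hpos : 0 < ∑ i, h x j i :=
      lt_of_le_of_ne (Finset.sum_nonneg (fun i _ => hh0 x j i)) (Ne.symm hne)
    have hlt : ∀ i, f x j i < 1 / n := by
      intro i
      by_cases hxi : x j i = 0
      · rw [h0 x hxP j i hxi]; positivity
      · have : 0 < x j i := lt_of_le_of_ne ((hxP j).1 i) (Ne.symm hxi)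
        have h2 : 0 < h x j i := by rw [hfix i]; positivity
        simp only [h, hr] at h2
        rcases lt_max_iff.1 h2 with h3 | h3
        · exact absurd h3 (lt_irrefl _)
        · linarith
    have : ∑ i, f x j i < ∑ i : Fin n, (1:ℝ) / n :=
      Finset.sum_lt_sum_of_nonempty ⟨⟨0, hn⟩, Finset.mem_univ _⟩ (fun i _ => hlt i)
    rw [hs x hxP j] at this
    simp [hn'.ne'] at this
  have hge : ∀ i, 1 / n ≤ f x j i := by
    intro i
    have h1 : h x j i = 0 := by rw [hfix i, hH, mul_zero]
    simp only [h, hr] at h1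
    have := le_max_right 0 (1 / (n:ℝ) - f x j i)
    linarith
  have heq : ∑ i : Fin n, (1:ℝ) / n = ∑ i, f x j i := by
    rw [hs x hxP j]; simp [hn'.ne']
  intro i
  exact ((Finset.sum_eq_sum_iff_of_le (fun i _ => hge i)).1 heq i (Finset.mem_univ i)).symm

/-- extension by zero at the extra coordinate -/
def oext {ι R : Type} [Zero R] (y : ι → R) : Option ι → R
  | none => 0
  | some a => y a

/-- bump function adapted to the Kuhn triangulation -/
noncomputable def bump {ι : Type} [Fintype ι] (y : ι → ℝ) : ℝ :=
  ∏ a : Option ι, ∏ b : Option ι, max 0 (1 - (oext y a - oext y b))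

lemma bump_nonneg {ι : Type} [Fintype ι] (y : ι → ℝ) : 0 ≤ bump y :=
  Finset.prod_nonneg fun _ _ => Finset.prod_nonneg fun _ _ => le_max_left _ _

lemma bump_cont {ι : Type} [Fintype ι] : Continuous (bump (ι := ι)) := by
  have : ∀ a : Option ι, Continuous (fun y : ι → ℝ => oext y a) := by
    intro a
    cases a with
    | none => exact continuous_const
    | some a => exact continuous_apply a
  unfold bump
  fun_prop

lemma bump_ne {ι : Type} [Fintype ι] (y : ι → ℝ) :
    bump y ≠ 0 ↔ ∀ a b, oext y a - oext y b < 1 := by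
  unfold bump
  simp only [Finset.prod_ne_zero_iff, Finset.mem_univ, true_imp_iff]
  refine forall_congr' fun a => forall_congr' fun b => ?_
  constructor
  · intro h
    by_contra h2
    apply h
    exact max_eq_left (by linarith)
  · intro h
    exact (lt_of_lt_of_le (by linarith) (le_max_right _ _)).ne'

lemma bump_floor {ι : Type} [Fintype ι] (y : ι → ℝ) :
    bump (fun i => y i - (⌊y i⌋ : ℤ)) ≠ 0 := by
  rw [bump_ne]
  have h : ∀ a, 0 ≤ oext (fun i => y i - (⌊y i⌋ : ℤ)) a ∧ oext (fun i => y i - (⌊y i⌋ : ℤ)) a < 1 := by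
    intro a
    cases a with
    | none => simp [oext]
    | some a => exact ⟨by simp only [oext]; linarith [Int.floor_le (y a)],
        by simp only [oext]; linarith [Int.lt_floor_add_one (y a)]⟩
  intro a b
  linarith [(h a).2, (h b).1]

lemma bump_color {ι : Type} [Fintype ι] (y : ι → ℝ) (z z' : ι → ℤ)
    (h : bump (fun i => y i - z i) ≠ 0) (h' : bump (fun i => y i - z' i) ≠ 0)
    (hc : ((∑ i, z i : ℤ) : ZMod (Fintype.card ι + 1)) = ((∑ i, z' i : ℤ) : ZMod (Fintype.card ι + 1))) :
    z = z' := by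
  rw [bump_ne] at h h'
  set w : ι → ℤ := fun i => z i - z' i with hw
  have hwab : ∀ a b, oext w a - oext w b ≤ 1 := by
    intro a b
    have h1 := h b a
    have h2 := h' a b
    have e : ∀ a, ((oext w a : ℤ) : ℝ) = oext (fun i => y i - z' i) a - oext (fun i => y i - z i) a := by
      intro a
      cases a with
      | none => simp [oext]
      | some a => simp [oext, hw]
    have : ((oext w a - oext w b : ℤ) : ℝ) < 2 := by
      push_cast; rw [e, e]; linarith
    have : oext w a - oext w b < 2 := by exact_mod_cast this
    omega
  have hup : ∀ i, w i ≤ 1 := fun i => by simpa [oext] using hwab (some i) none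
  have hlo : ∀ i, -1 ≤ w i := fun i => by have := hwab none (some i); simp [oext] at this; omega
  have hdiff : ∀ i j, w i - w j ≤ 1 := fun i j => by simpa [oext] using hwab (some i) (some j)
  have hdvd : ((Fintype.card ι + 1 : ℕ) : ℤ) ∣ ∑ i, w i := by
    rw [← ZMod.intCast_zmod_eq_zero_iff_dvd]
    simp only [hw]
    rw [Finset.sum_sub_distrib, Int.cast_sub, hc, sub_self]
  have hle : ∑ i, w i ≤ Fintype.card ι := by
    have := Finset.sum_le_sum (fun i (_ : i ∈ univ) => hup i)
    simpa using this
  have hge : -(Fintype.card ι : ℤ) ≤ ∑ i, w i := by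
    have := Finset.sum_le_sum (fun i (_ : i ∈ univ) => hlo i)
    simpa using this
  have hz : ∑ i, w i = 0 := by
    apply Int.eq_zero_of_abs_lt_dvd hdvd
    rw [abs_lt]; push_cast; constructor <;> omega
  have hzero : ∀ i, w i = 0 := by
    by_cases hex : ∃ i, w i = 1
    · obtain ⟨i0, hi0⟩ := hex
      have hnn : ∀ i ∈ univ, 0 ≤ w i := fun i _ => by have := hdiff i0 i; omega
      intro i
      exact (Finset.sum_eq_zero_iff_of_nonneg hnn).1 hz i (Finset.mem_univ i)
    · have hnp : ∀ i ∈ univ, w i ≤ 0 := fun i _ => by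
        have := hup i
        have : w i ≠ 1 := fun h => hex ⟨i, h⟩
        omega
      intro i
      exact (Finset.sum_eq_zero_iff_of_nonpos hnp).1 hz i (Finset.mem_univ i)
  funext i
  have := hzero i
  simp only [hw] at this
  omega

/-- truncation -/
lemma trunc {n : ℕ} (hn : 0 < n) (δ : ℝ) (hδ : 0 < δ) (hδn : δ * n < 1) (x : Fin n → ℝ)
    (hx : x ∈ stdSimplex ℝ (Fin n)) :
    ∃ y ∈ stdSimplex ℝ (Fin n), (∀ i, x i ≤ δ → y i = 0) ∧ ∀ i, |y i - x i| ≤ n * δ := by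
  have hn1 : (1:ℝ) ≤ n := by exact_mod_cast hn
  set t : Fin n → ℝ := fun i => max (x i - δ) 0 with ht
  have ht0 : ∀ i, 0 ≤ t i := fun i => le_max_right _ _
  have htx : ∀ i, x i - δ ≤ t i := fun i => le_max_left _ _
  have htx' : ∀ i, t i ≤ x i := fun i => max_le (by linarith) (hx.1 i)
  have hs1 : ∑ i, t i ≤ 1 := by rw [← hx.2]; exact Finset.sum_le_sum fun i _ => htx' i
  have hs0 : 0 < ∑ i, t i := by
    have : ∑ i, (x i - δ) ≤ ∑ i, t i := Finset.sum_le_sum fun i _ => htx i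
    rw [Finset.sum_sub_distrib, hx.2] at this
    simp at this
    linarith
  have hy : (fun i => t i / ∑ i, t i) ∈ stdSimplex ℝ (Fin n) :=
    ⟨fun i => div_nonneg (ht0 i) hs0.le, by rw [← Finset.sum_div, div_self hs0.ne']⟩
  have hlow : ∀ i, x i - δ ≤ t i / ∑ i, t i := fun i =>
    (htx i).trans (le_div_self (ht0 i) hs0 hs1)
  refine ⟨_, hy, ?_, ?_⟩
  · intro i hi
    have : t i = 0 := max_eq_right (by linarith)
    simp [this]
  · intro i
    rw [abs_le]
    constructor
    · have := hlow i
      nlinarith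
    · have h1 : ∑ i' ∈ univ.erase i, (x i' - δ) ≤ ∑ i' ∈ univ.erase i, t i' / ∑ i, t i :=
        Finset.sum_le_sum fun i _ => hlow i
      rw [Finset.sum_sub_distrib] at h1
      have h2 := Finset.add_sum_erase univ (fun i' => t i' / ∑ i, t i) (Finset.mem_univ i)
      have h3 := Finset.add_sum_erase univ x (Finset.mem_univ i)
      rw [hy.2] at h2
      rw [hx.2] at h3
      simp only [Finset.sum_const, Finset.card_erase_of_mem (Finset.mem_univ i), Finset.card_univ,
        Fintype.card_fin, nsmul_eq_mul] at h1
      rw [Nat.cast_sub hn] at h1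
      push_cast at h1
      nlinarith


lemma close_of_bump {k q : ℕ} (M : ℕ) (hM : 0 < M) (z : Fin k × Fin q → ℤ)
    (x x' : Fin k → Fin (q+1) → ℝ) (hx : x ∈ cakeP k (q+1)) (hx' : x' ∈ cakeP k (q+1))
    (h : bump (fun a : Fin k × Fin q => M * x a.1 a.2.castSucc - z a) ≠ 0)
    (h' : bump (fun a : Fin k × Fin q => M * x' a.1 a.2.castSucc - z a) ≠ 0) (j i) :
    |x j i - x' j i| ≤ 2 * (q+1) / M := by
  rw [bump_ne] at h h'
  have hM' : (0:ℝ) < M := by exact_mod_cast hM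
  have hc : ∀ i : Fin q, |x j i.castSucc - x' j i.castSucc| ≤ 2 / M := by
    intro i
    have h1 := h (some (j,i)) none
    have h2 := h none (some (j,i))
    have h3 := h' (some (j,i)) none
    have h4 := h' none (some (j,i))
    simp only [oext] at h1 h2 h3 h4
    rw [le_div_iff₀ hM', ← abs_of_pos hM', ← abs_mul, abs_le]
    constructor <;> nlinarith
  have hq : (2:ℝ) / M * (q+1) = 2 * (q+1) / M := by ring
  have h2M : (0:ℝ) < 2 / M := by positivity
  induction i using Fin.lastCases with
  | cast i =>
    rw [← hq]
    have : (0:ℝ) ≤ q := by positivity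
    nlinarith [hc i]
  | last =>
    have e1 := (hx j).2
    have e2 := (hx' j).2
    rw [Fin.sum_univ_castSucc] at e1 e2
    have : x j (Fin.last q) - x' j (Fin.last q)
        = -∑ i : Fin q, (x j i.castSucc - x' j i.castSucc) := by
      rw [Finset.sum_sub_distrib]; linarith
    rw [this, abs_neg]
    have h5 := Finset.abs_sum_le_sum_abs (fun i : Fin q => x j i.castSucc - x' j i.castSucc) univ
    have h6 : ∑ i : Fin q, |x j i.castSucc - x' j i.castSucc| ≤ ∑ i : Fin q, (2:ℝ)/M :=
      Finset.sum_le_sum fun i _ => hc i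
    simp at h6
    rw [← hq]
    nlinarith

lemma choose_pt {k q p : ℕ}
    (pref : Fin p → (Fin k → Fin (q+1) → ℝ) → (Fin k → Fin (q+1)) → Prop)
    (hungry : ∀ a : Fin p, ∀ x : Fin k → Fin (q+1) → ℝ, x ∈ cakeP k (q+1) →
      ∃ I : Fin k → Fin (q+1), pref a x I ∧ ∀ j, x j (I j) ≠ 0)
    (ε : ℝ) (hε : 0 < ε) :
    ∃ M : ℕ, 0 < M ∧ ∀ (z : Fin k × Fin q → ℤ) (a : Fin p),
      ∃ (y : Fin k → Fin (q+1) → ℝ) (I : Fin k → Fin (q+1)), y ∈ cakeP k (q+1) ∧ pref a y I ∧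
        ∀ x ∈ cakeP k (q+1), bump (fun a : Fin k × Fin q => M * x a.1 a.2.castSucc - z a) ≠ 0 →
          (∀ j, x j (I j) ≠ 0) ∧ ∀ j i, |y j i - x j i| ≤ ε := by
  obtain ⟨δ, hδ, hδ1, hδ2⟩ : ∃ δ : ℝ, 0 < δ ∧ δ * ((q+1 : ℕ):ℝ) < 1 ∧ (((q+1:ℕ):ℝ) + 1) * δ ≤ ε := by
    have hp : (0:ℝ) < ((q+1:ℕ):ℝ) + 1 := by positivity
    refine ⟨min ε 1 / (((q+1:ℕ):ℝ) + 1), by positivity, ?_, ?_⟩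
    · rw [div_mul_eq_mul_div, div_lt_one hp]
      have : min ε 1 ≤ 1 := min_le_right _ _
      have : (0:ℝ) < ((q+1:ℕ):ℝ) := by positivity
      nlinarith
    · rw [mul_div_cancel₀ _ hp.ne']; exact min_le_left _ _
  obtain ⟨M, hM⟩ := exists_nat_gt (2 * (q+1) / δ : ℝ)
  have hMpos : (0:ℝ) < M := lt_of_le_of_lt (by positivity) hM
  have hM0 : 0 < M := by exact_mod_cast hMpos
  have hMd : (2 * (q+1) / M : ℝ) ≤ δ := by
    rw [div_lt_iff₀ hδ] at hM
    rw [div_le_iff₀ hMpos]; linarith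
  refine ⟨M, hM0, fun z a => ?_⟩
  by_cases hex : ∃ x0 ∈ cakeP k (q+1), bump (fun a : Fin k × Fin q => M * x0 a.1 a.2.castSucc - z a) ≠ 0
  · obtain ⟨x0, hx0, hb0⟩ := hex
    choose y hyP hy0 hyc using fun j => trunc (Nat.succ_pos q) δ hδ hδ1 (x0 j) (hx0 j)
    obtain ⟨I, hI, hIs⟩ := hungry a y hyP
    refine ⟨y, I, hyP, hI, fun x hx hb => ?_⟩
    have hcl := fun j i => (close_of_bump M hM0 z x0 x hx0 hx hb0 hb j i).trans hMd
    refine ⟨fun j h => hIs j (hy0 j _ ?_), fun j i => ?_⟩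
    · have := hcl j (I j)
      rw [h, sub_zero] at this
      exact (le_abs_self _).trans this
    · have h1 := hyc j i
      have h2 := hcl j i
      have : y j i - x j i = (y j i - x0 j i) + (x0 j i - x j i) := by ring
      rw [this]
      refine (abs_add_le _ _).trans ?_
      simp only [Nat.succ_eq_add_one] at h1
      linarith
  · push Not at hex
    have hP : (fun _ => Pi.single 0 1 : Fin k → Fin (q+1) → ℝ) ∈ cakeP k (q+1) :=
      fun j => single_mem_stdSimplex ℝ 0
    obtain ⟨I, hI, -⟩ := hungry a _ hP
    exact ⟨_, I, hP, hI, fun x hx hb => absurd (hex x hx) hb⟩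

lemma core_pt {k q : ℕ} (hk : 2 ≤ k) {Z : Type} [Fintype Z] [DecidableEq Z]
    (ps : Z → (Fin k → Fin (q+1) → ℝ) → ℝ) (I : Z → Fin k → Fin (q+1))
    (hps0 : ∀ z x, 0 ≤ ps z x) (hpsc : ∀ z, Continuous (ps z))
    (htot' : ∀ x ∈ cakeP k (q+1), ∃ z, ps z x ≠ 0)
    (hyx : ∀ z, ∀ x ∈ cakeP k (q+1), ps z x ≠ 0 → ∀ j, x j (I z j) ≠ 0) :
    ∃ x ∈ cakeP k (q+1), ∃ M' : Finset Z, (∀ z ∈ M', ps z x ≠ 0) ∧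
      (M' : Set Z).Pairwise (fun e f => ∀ j, I e j ≠ I f j) ∧
      ((q+1:ℕ):ℝ) ≤ ((k:ℝ) - 1) * M'.card := by
  let tot : (Fin k → Fin (q+1) → ℝ) → ℝ := fun x => ∑ z : Z, ps z x
  have htotc : Continuous tot := continuous_finsetSum _ fun z _ => hpsc z
  have htot : ∀ x ∈ cakeP k (q+1), 0 < tot x := by
    intro x hx
    obtain ⟨z, hz⟩ := htot' x hx
    exact lt_of_lt_of_le (lt_of_le_of_ne (hps0 z x) (Ne.symm hz))
      (Finset.single_le_sum (f := fun z : Z => ps z x) (fun z _ => hps0 z x) (Finset.mem_univ z))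
  let f : (Fin k → Fin (q+1) → ℝ) → Fin k → Fin (q+1) → ℝ :=
    fun x j i => (∑ z : Z, if I z j = i then ps z x else 0) / tot x
  obtain ⟨x, hx, hfx⟩ := hit_bary (Nat.succ_pos q) f
    (by
      refine continuousOn_pi.2 fun j => continuousOn_pi.2 fun i => ?_
      refine ContinuousOn.div (Continuous.continuousOn ?_) htotc.continuousOn
        (fun x hx => (htot x hx).ne')
      refine continuous_finsetSum _ fun z _ => ?_
      split_ifs
      · exact hpsc z
      · exact continuous_const)
    (by
      intro x hx j
      simp only [f]
      rw [← Finset.sum_div, Finset.sum_comm, div_eq_one_iff_eq (htot x hx).ne']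
      refine Finset.sum_congr rfl fun z _ => ?_
      simp)
    (by
      intro x hx j i hxi
      simp only [f]
      rw [Finset.sum_eq_zero, zero_div]
      intro z _
      split_ifs with h
      · by_contra hne
        exact hyx z x hx hne j (h ▸ hxi)
      · rfl)
  have hn' : (0:ℝ) < ((q+1:ℕ):ℝ) := by positivity
  have ht := htot x hx
  obtain ⟨M', hM'S, hM'd, hM'c⟩ := furedi (E := Z) hk (fun z => I z) _
    (univ.filter (fun z : Z => ps z x ≠ 0)) le_rfl (fun z => ((q+1:ℕ):ℝ) / tot x * ps z x)
    (fun z => by have := hps0 z x; positivity)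
    (fun z hz => by
      have : ps z x = 0 := by simpa using hz
      simp [this])
    (fun j i => by
      have h1 := hfx j i
      simp only [f] at h1
      unfold hdeg
      have : ∀ z : Z, (if I z j = i then ((q+1:ℕ):ℝ) / tot x * ps z x else 0)
          = ((q+1:ℕ):ℝ) / tot x * (if I z j = i then ps z x else 0) := fun z => by
        split_ifs <;> simp
      rw [Finset.sum_congr rfl (fun z _ => this z), ← Finset.mul_sum, div_mul_eq_mul_div,
        mul_div_assoc, h1]
      simp only [Nat.succ_eq_add_one]
      rw [mul_one_div_cancel hn'.ne'])
  rw [← Finset.mul_sum] at hM'c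
  have e1 : ((q+1:ℕ):ℝ) / tot x * ∑ z : Z, ps z x = ((q+1:ℕ):ℝ) := div_mul_cancel₀ _ ht.ne'
  rw [e1] at hM'c
  have hS : ∀ z ∈ M', ps z x ≠ 0 := fun z hz => (Finset.mem_filter.1 (hM'S hz)).2
  exact ⟨x, hx, M', hS, hM'd, hM'c⟩

lemma approx {k q p : ℕ} (hk : 2 ≤ k) (m : ℕ)
    (pref : Fin p → (Fin k → Fin (q+1) → ℝ) → (Fin k → Fin (q+1)) → Prop)
    (hungry : ∀ a : Fin p, ∀ x : Fin k → Fin (q+1) → ℝ, x ∈ cakeP k (q+1) →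
      ∃ I : Fin k → Fin (q+1), pref a x I ∧ ∀ j, x j (I j) ≠ 0)
    (pl : ZMod (k*q+1) → Fin p) (hpl : ∀ a, (univ.filter (fun c => pl c = a)).card ≤ m)
    (ε : ℝ) (hε : 0 < ε) :
    ∃ x ∈ cakeP k (q+1), ∃ (A : Finset (Fin p)) (sel : Fin p → Fin k → Fin (q+1)),
      ((q+1:ℕ):ℝ) ≤ ((k:ℝ) - 1) * (m * A.card) ∧
      (A : Set (Fin p)).Pairwise (fun a b => ∀ j, sel a j ≠ sel b j) ∧
      ∀ a ∈ A, ∃ y ∈ cakeP k (q+1), pref a y (sel a) ∧ ∀ j i, |y j i - x j i| ≤ ε := by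
  obtain ⟨M, hM, hch⟩ := choose_pt pref hungry ε hε
  let col : (Fin k × Fin q → ℤ) → ZMod (k*q+1) := fun z => ((∑ a, z a : ℤ) : ZMod (k*q+1))
  choose y I hyP hyI hyx using fun z => hch z (pl (col z))
  let ps : (Fin k × Fin q → ℤ) → (Fin k → Fin (q+1) → ℝ) → ℝ :=
    fun z x => bump (fun a : Fin k × Fin q => M * x a.1 a.2.castSucc - z a)
  have hps0 : ∀ z x, 0 ≤ ps z x := fun z x => bump_nonneg _
  have hpsc : ∀ z, Continuous (ps z) := fun z => by
    refine bump_cont.comp (continuous_pi fun a => ?_)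
    have : Continuous (fun x : Fin k → Fin (q+1) → ℝ => x a.1 a.2.castSucc) :=
      (continuous_apply _).comp (continuous_apply _)
    exact (continuous_const.mul this).sub continuous_const
  let Z : Finset (Fin k × Fin q → ℤ) := Fintype.piFinset (fun _ => Finset.Icc 0 (M:ℤ))
  have htot : ∀ x ∈ cakeP k (q+1), ∃ z : Z, ps z x ≠ 0 := by
    intro x hx
    have hz : (fun a : Fin k × Fin q => ⌊(M:ℝ) * x a.1 a.2.castSucc⌋) ∈ Z := by
      refine Fintype.mem_piFinset.2 fun a => Finset.mem_Icc.2 ?_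
      have h0 : 0 ≤ x a.1 a.2.castSucc := (hx a.1).1 _
      have h1 : x a.1 a.2.castSucc ≤ 1 := by
        rw [← (hx a.1).2]
        exact Finset.single_le_sum (fun i _ => (hx a.1).1 i) (Finset.mem_univ _)
      have hM' : (0:ℝ) < M := by exact_mod_cast hM
      refine ⟨Int.floor_nonneg.2 (by positivity), ?_⟩
      have : ((⌊(M:ℝ) * x a.1 a.2.castSucc⌋ : ℤ):ℝ) ≤ ((M:ℤ):ℝ) :=
        (Int.floor_le _).trans (by push_cast; nlinarith)
      exact_mod_cast this
    refine ⟨⟨_, hz⟩, ?_⟩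
    exact bump_floor (fun a : Fin k × Fin q => (M:ℝ) * x a.1 a.2.castSucc)
  classical
  obtain ⟨x, hx, M', hS, hM'd, hM'c⟩ := core_pt hk (fun z : Z => ps z) (fun z => I z)
    (fun z x => hps0 z x) (fun z => hpsc z) htot (fun z x hx h => (hyx z x hx h).1)
  let g : Z → Fin p := fun z => pl (col z)
  have hcol : ∀ z ∈ M', ∀ z' ∈ M', col z = col z' → z = z' := by
    intro z hz z' hz' hcc
    apply Subtype.ext
    have hcard : Fintype.card (Fin k × Fin q) = k * q := by simp
    refine bump_color (fun a : Fin k × Fin q => (M:ℝ) * x a.1 a.2.castSucc) z z' (hS z hz) (hS z' hz') ?_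
    rw [hcard]
    exact hcc
  have hcardM : M'.card ≤ m * (M'.image g).card := by
    refine Finset.card_le_mul_card_image M' m fun a _ => ?_
    refine le_trans ?_ (hpl a)
    refine Finset.card_le_card_of_injOn (fun z => col z) (fun z hz => ?_) (fun z hz z' hz' h => ?_)
    · simpa using (Finset.mem_filter.1 hz).2
    · exact hcol z (Finset.mem_filter.1 hz).1 z' (Finset.mem_filter.1 hz').1 h
  have hrep : ∀ a : Fin p, ∃ z : Fin k × Fin q → ℤ, a ∈ M'.image g → ∃ h : z ∈ Z, ⟨z, h⟩ ∈ M' ∧ g ⟨z, h⟩ = a := by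
    intro a
    by_cases ha : a ∈ M'.image g
    · obtain ⟨z, hz, hza⟩ := Finset.mem_image.1 ha
      exact ⟨z.1, fun _ => ⟨z.2, hz, hza⟩⟩
    · exact ⟨0, fun h => absurd h ha⟩
  choose r hr using hrep
  refine ⟨x, hx, M'.image g, fun a => I (r a), ?_, ?_, ?_⟩
  · have hk1 : (0:ℝ) ≤ (k:ℝ) - 1 := by
      have : (2:ℝ) ≤ k := by exact_mod_cast hk
      linarith
    refine hM'c.trans (mul_le_mul_of_nonneg_left ?_ hk1)
    exact_mod_cast hcardM
  · intro a ha b hb hab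
    obtain ⟨h1, h2, h3⟩ := hr a ha
    obtain ⟨h1', h2', h3'⟩ := hr b hb
    refine hM'd h2 h2' fun h => hab ?_
    rw [← h3, ← h3', h]
  · intro a ha
    obtain ⟨h1, h2, h3⟩ := hr a ha
    have h3 : pl (col (r a)) = a := h3
    have hb : ps (r a) x ≠ 0 := hS ⟨r a, h1⟩ h2
    have h4 := (hyx (r a) x hx hb).2
    refine ⟨y (r a), hyP _, ?_, h4⟩
    have := hyI (r a)
    rwa [h3] at this

lemma cakeP_compact (k n : ℕ) : IsCompact (cakeP k n) := by
  have : cakeP k n = Set.pi Set.univ (fun _ => stdSimplex ℝ (Fin n)) := by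
    ext x; simp [cakeP]
  rw [this]
  exact isCompact_univ_pi fun _ => isCompact_stdSimplex ℝ (Fin n)

lemma exact_div {k q p : ℕ} (hk : 2 ≤ k) (m : ℕ)
    (pref : Fin p → (Fin k → Fin (q+1) → ℝ) → (Fin k → Fin (q+1)) → Prop)
    (hungry : ∀ a : Fin p, ∀ x : Fin k → Fin (q+1) → ℝ, x ∈ cakeP k (q+1) →
      ∃ I : Fin k → Fin (q+1), pref a x I ∧ ∀ j, x j (I j) ≠ 0)
    (hclosed : ∀ (a : Fin p) (I : Fin k → Fin (q+1)),
      IsClosed {x : Fin k → Fin (q+1) → ℝ | x ∈ cakeP k (q+1) ∧ pref a x I})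
    (pl : ZMod (k*q+1) → Fin p) (hpl : ∀ a, (univ.filter (fun c => pl c = a)).card ≤ m) :
    ∃ x ∈ cakeP k (q+1), ∃ (A : Finset (Fin p)) (sel : Fin p → Fin k → Fin (q+1)),
      ((q+1:ℕ):ℝ) ≤ ((k:ℝ) - 1) * (m * A.card) ∧
      (A : Set (Fin p)).Pairwise (fun a b => ∀ j, sel a j ≠ sel b j) ∧
      ∀ a ∈ A, pref a x (sel a) := by
  choose X hX A sel hc hd hy using fun t : ℕ =>
    approx hk m pref hungry pl hpl (1 / ((t:ℝ) + 1)) (by positivity)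
  obtain ⟨⟨A0, s0⟩, hinf⟩ := Finite.exists_infinite_fiber (fun t => (A t, sel t))
  have hinf := Set.infinite_coe_iff.1 hinf
  let φ := Nat.nth (fun t => (A t, sel t) = (A0, s0))
  have hφ : ∀ t, (A (φ t), sel (φ t)) = (A0, s0) := fun t => Nat.nth_mem_of_infinite hinf t
  have hφm : StrictMono φ := Nat.nth_strictMono hinf
  have hA : ∀ t, A (φ t) = A0 := fun t => congrArg Prod.fst (hφ t)
  have hs : ∀ t, sel (φ t) = s0 := fun t => congrArg Prod.snd (hφ t)
  obtain ⟨x, hx, ψ, hψ, hlim⟩ := (cakeP_compact k (q+1)).tendsto_subseq (fun t => hX (φ t))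
  refine ⟨x, hx, A0, s0, ?_, ?_, fun a ha => ?_⟩
  · have := hc (φ 0); rwa [hA] at this
  · have := hd (φ 0); rwa [hA, hs] at this
  · have hy' : ∀ t, ∃ y ∈ cakeP k (q+1), pref a y (s0 a) ∧ ∀ j i, |y j i - X (φ (ψ t)) j i| ≤ 1 / ((t:ℝ)+1) := by
      intro t
      have := hy (φ (ψ t)) a (by rw [hA]; exact ha)
      rw [hs] at this
      obtain ⟨y, h1, h2, h3⟩ := this
      refine ⟨y, h1, h2, fun j i => (h3 j i).trans ?_⟩
      have : (t:ℝ) ≤ ((φ (ψ t) : ℕ) : ℝ) := by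
        exact_mod_cast (hψ.le_apply).trans hφm.le_apply
      exact one_div_le_one_div_of_le (by positivity) (by linarith)
    choose y h1 h2 h3 using hy'
    have hlim2 : Filter.Tendsto y Filter.atTop (nhds x) := by
      refine tendsto_pi_nhds.2 fun j => tendsto_pi_nhds.2 fun i => ?_
      have e1 : Filter.Tendsto (fun t => X (φ (ψ t)) j i) Filter.atTop (nhds (x j i)) :=
        (tendsto_pi_nhds.1 ((tendsto_pi_nhds.1 hlim) j)) i
      have e2 : Filter.Tendsto (fun t => y t j i - X (φ (ψ t)) j i) Filter.atTop (nhds 0) :=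
        squeeze_zero_norm (fun t => by rw [Real.norm_eq_abs]; exact h3 t j i)
          tendsto_one_div_add_atTop_nhds_zero_nat
      have e3 := e1.add e2
      simpa using e3
    exact ((hclosed a (s0 a)).mem_of_tendsto hlim2
      (Filter.Eventually.of_forall fun t => ⟨h1 t, h2 t⟩)).2

lemma fiber_bound (N p : ℕ) [NeZero N] (hp : 0 < p) (a : Fin p) :
    (univ.filter (fun c : ZMod N => (⟨c.val % p, Nat.mod_lt _ hp⟩ : Fin p) = a)).card
      ≤ (N - 1) / p + 1 := by
  have : ((N - 1) / p + 1) = (Finset.range ((N - 1) / p + 1)).card := by simp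
  rw [this]
  refine Finset.card_le_card_of_injOn (fun c => c.val / p) (fun c hc => ?_) (fun c hc d hd h => ?_)
  · have := ZMod.val_lt c
    simp only [Finset.coe_range, Set.mem_Iio]
    exact Nat.lt_succ_of_le (Nat.div_le_div_right (by omega))
  · have h1 := congrArg Fin.val (Finset.mem_filter.1 hc).2
    have h2 := congrArg Fin.val (Finset.mem_filter.1 hd).2
    simp only at h1 h2 h
    apply ZMod.val_injective N
    rw [← Nat.div_add_mod c.val p, ← Nat.div_add_mod d.val p, h, h1, h2]

lemma final_arith (k q p m r c : ℕ) (hk : 2 ≤ k) (hr : 0 < r) (hpm : p * m ≤ r * (k*q+1))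
    (h : ((q+1:ℕ):ℝ) ≤ ((k:ℝ) - 1) * (m * c)) :
    (p:ℝ) / (r * k * ((k:ℝ) - 1)) ≤ c := by
  have hk' : (2:ℝ) ≤ k := by exact_mod_cast hk
  have hr' : (0:ℝ) < r := by exact_mod_cast hr
  have hk1 : (0:ℝ) < (k:ℝ) - 1 := by linarith
  rw [div_le_iff₀ (by positivity)]
  have hN : (0:ℝ) < (k:ℝ) * q + 1 := by positivity
  have hpm' : (p:ℝ) * m ≤ r * ((k:ℝ) * q + 1) := by exact_mod_cast hpm
  have hNk : (k:ℝ) * q + 1 ≤ k * ((q+1:ℕ):ℝ) := by push_cast; nlinarith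
  have hck : (0:ℝ) ≤ k * ((k:ℝ) - 1) * c := by positivity
  refine le_of_mul_le_mul_right ?_ hN
  calc (p:ℝ) * ((k:ℝ) * q + 1) ≤ p * (k * (((k:ℝ) - 1) * (m * c))) := by
        refine mul_le_mul_of_nonneg_left (hNk.trans ?_) (by positivity)
        exact mul_le_mul_of_nonneg_left h (by positivity)
    _ = (k * ((k:ℝ) - 1) * c) * (p * m) := by ring
    _ ≤ (k * ((k:ℝ) - 1) * c) * (r * ((k:ℝ) * q + 1)) := mul_le_mul_of_nonneg_left hpm' hck
    _ = _ := by ring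



/-- **Fair division of `k` cakes.**  A division of `k` cakes into `n` pieces each is a point
of `P(n,k) = (Δ_{n-1})^k`, encoded as `x : Fin k → Fin n → ℝ` with each `x j` in the standard
simplex.  A `k`-piece selection is `I : Fin k → Fin n` (one piece from each cake); two
selections are disjoint if they differ in every coordinate.  There are `p ≤ k(n-1)+1` hungry
players with closed preferences, each of whom prefers at least one selection supported on
nonempty pieces at every division.  Then there is a division in which at least
`⌈p / (2k(k-1))⌉` players prefer mutually disjoint selections (expressed via the equivalent
real inequality); if `p` divides `k(n-1)+1`, at least `⌈p / (k(k-1))⌉` players can be so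
satisfied. -/
theorem k_cakes_division (n k p : ℕ) (hn : 0 < n) (hk : 2 ≤ k) (hp : 0 < p)
    (hpn : p ≤ k * (n - 1) + 1)
    (pref : Fin p → (Fin k → Fin n → ℝ) → (Fin k → Fin n) → Prop)
    (hungry : ∀ a : Fin p, ∀ x : Fin k → Fin n → ℝ,
      (∀ j, x j ∈ stdSimplex ℝ (Fin n)) →
      ∃ I : Fin k → Fin n, pref a x I ∧ ∀ j, x j (I j) ≠ 0)
    (hclosed : ∀ (a : Fin p) (I : Fin k → Fin n),
      IsClosed {x : Fin k → Fin n → ℝ | (∀ j, x j ∈ stdSimplex ℝ (Fin n)) ∧ pref a x I}) :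
    (∃ x : Fin k → Fin n → ℝ, (∀ j, x j ∈ stdSimplex ℝ (Fin n)) ∧
      ∃ (A : Finset (Fin p)) (sel : Fin p → Fin k → Fin n),
        (p : ℝ) / (2 * k * ((k : ℝ) - 1)) ≤ A.card ∧
        (∀ a ∈ A, pref a x (sel a)) ∧
        (A : Set (Fin p)).Pairwise (fun a b => ∀ j, sel a j ≠ sel b j)) ∧
    (p ∣ k * (n - 1) + 1 → ∃ x : Fin k → Fin n → ℝ, (∀ j, x j ∈ stdSimplex ℝ (Fin n)) ∧
      ∃ (A : Finset (Fin p)) (sel : Fin p → Fin k → Fin n),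
        (p : ℝ) / ((k : ℝ) * ((k : ℝ) - 1)) ≤ A.card ∧
        (∀ a ∈ A, pref a x (sel a)) ∧
        (A : Set (Fin p)).Pairwise (fun a b => ∀ j, sel a j ≠ sel b j)) := by
  obtain ⟨q, rfl⟩ : ∃ q, n = q + 1 := ⟨n - 1, by omega⟩
  simp only [Nat.add_sub_cancel] at hpn ⊢
  obtain ⟨x, hx, A, sel, hc, hd, hA⟩ := exact_div hk ((k*q+1 - 1)/p + 1) pref hungry hclosed
    (fun c => ⟨c.val % p, Nat.mod_lt _ hp⟩) (fun a => fiber_bound (k*q+1) p hp a)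
  refine ⟨⟨x, hx, A, sel, ?_, hA, hd⟩, fun hdvd => ⟨x, hx, A, sel, ?_, hA, hd⟩⟩
  · have := final_arith k q p _ 2 A.card hk two_pos (by
      have := Nat.mul_div_le (k*q+1-1) p
      rw [Nat.mul_add]
      omega) hc
    simpa using this
  · have := final_arith k q p _ 1 A.card hk one_pos (by
      obtain ⟨d, hd⟩ := hdvd
      have hd0 : d ≠ 0 := by rintro rfl; omega
      obtain ⟨d, rfl⟩ := Nat.exists_eq_succ_of_ne_zero hd0
      have e : (k*q+1-1)/p = d := by
        rw [hd]
        have : p * (d+1) - 1 = (p - 1) + p * d := by rw [Nat.mul_add]; omega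
        rw [Nat.succ_eq_add_one, this, Nat.add_mul_div_left _ _ hp, Nat.div_eq_of_lt (by omega), zero_add]
      rw [e, hd, one_mul]) hc
    simpa using this
end

section
/- Consider p ≥ k(n−1)+1 employees who, for any partition of k days into n shifts each (a point of P(n,k)), each prefer at least one k-shift selection, prefer empty shifts when available, and have closed preference sets. Then there exists a partition of the k days into n shifts each for which a subset of at most n(1 + ln k) employees covers all kn shifts; moreover if k = 2, a subset of n employees suffices. -/
open Finset

theorem sc_pigeon {α β : Type*} [DecidableEq α] [DecidableEq β] (f : α → β) (s : Finset α)
    (h : (s.image f).card + 1 = s.card) :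
    ∃ a ∈ s, ∃ b ∈ s, a ≠ b ∧ f a = f b ∧
      ∀ x ∈ s, ∀ y ∈ s, x ≠ y → f x = f y → (x = a ∧ y = b) ∨ (x = b ∧ y = a) := by
  obtain ⟨a, ha, b, hb, hab, hf⟩ :=
    Finset.exists_ne_map_eq_of_card_lt_of_maps_to (s := s) (t := s.image f) (f := f)
      (by omega) (fun x hx => by simpa using ⟨x, hx, rfl⟩)
  refine ⟨a, ha, b, hb, hab, hf, ?_⟩
  have key : ∀ a ∈ s, ∀ b ∈ s, a ≠ b → f a = f b → ∀ x ∈ s, ∀ y ∈ s, x ≠ a → y ≠ a →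
      f x = f y → x = y := by
    intro a ha b hb hab hf x hx y hy hxa hya hxy
    have himg : (s.erase a).image f = s.image f := by
      ext z
      simp only [mem_image, mem_erase]
      constructor
      · rintro ⟨w, hw, rfl⟩; exact ⟨w, hw.2, rfl⟩
      · rintro ⟨w, hw, rfl⟩
        by_cases hwa : w = a
        · exact ⟨b, ⟨hab.symm, hb⟩, by rw [hwa, hf]⟩
        · exact ⟨w, ⟨hwa, hw⟩, rfl⟩
    have hinj : Set.InjOn f (s.erase a) := by
      apply Finset.injOn_of_card_image_eq
      rw [himg, Finset.card_erase_of_mem ha]; omega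
    exact hinj (by simp [hx, hxa]) (by simp [hy, hya]) hxy
  intro x hx y hy hxy hfxy
  have h1 := key a ha b hb hab hf x hx y hy
  have h2 := key b hb a ha hab.symm hf.symm x hx y hy
  by_cases hxa : x = a <;> by_cases hya : y = a <;> by_cases hxb : x = b <;> by_cases hyb : y = b <;>
    simp_all

def ScDom {V I : Type*} (u : I → V → ℕ) (S : Finset V) : Prop :=
  ∀ y, ∃ i, ∀ x ∈ S, u i y ≤ u i x

theorem sc_min {V I : Type*} (u : I → V → ℕ) (S : Finset V) (h : S.Nonempty) :
    ∃ m : I → V, (∀ i, m i ∈ S) ∧ ∀ i, ∀ x ∈ S, u i (m i) ≤ u i x := by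
  have : ∀ i, ∃ x ∈ S, ∀ y ∈ S, u i x ≤ u i y := fun i => Finset.exists_min_image S (u i) h
  choose m h1 h2 using this
  exact ⟨m, h1, h2⟩

theorem sc_surj {V I : Type*} (u : I → V → ℕ) (hu : ∀ i, Function.Injective (u i))
    (S : Finset V) (hD : ScDom u S) (m : I → V) (h1 : ∀ i, m i ∈ S)
    (h2 : ∀ i, ∀ x ∈ S, u i (m i) ≤ u i x) (x : V) (hx : x ∈ S) : ∃ i, m i = x := by
  obtain ⟨i, hi⟩ := hD x
  exact ⟨i, hu i (le_antisymm (h2 i x hx) (hi _ (h1 i)))⟩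

theorem sc_door {V I : Type*} [Fintype V] [DecidableEq V] [Fintype I] [DecidableEq I]
    (u : I → V → ℕ) (hu : ∀ i, Function.Injective (u i)) (s : I → V)
    (τ : Finset V) (hD : ScDom u τ) (hcard : τ.card + 1 = Fintype.card I)
    (hv : ∃ v ∈ τ, ∀ q l, q ≠ l → u q v < u q (s l)) [DecidablePred fun x => x ∉ τ ∧ ScDom u (insert x τ)] :
    (univ.filter fun x => x ∉ τ ∧ ScDom u (insert x τ)).card = 2 := by
  obtain ⟨v, hvτ, hv⟩ := hv
  obtain ⟨m, h1, h2⟩ := sc_min u τ ⟨v, hvτ⟩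
  have hs := sc_surj u hu τ hD m h1 h2
  have himg : univ.image m = τ := by
    ext x; simp only [mem_image, mem_univ, true_and]
    exact ⟨fun ⟨i, hi⟩ => hi ▸ h1 i, hs x⟩
  obtain ⟨i, -, j, -, hij, hm, huniq⟩ := sc_pigeon m univ (by rw [himg, hcard, Finset.card_univ])
  have hY : ∀ l, ∃ x, (∀ q, q ≠ l → u q (m q) < u q x) ∧
      ∀ y, (∀ q, q ≠ l → u q (m q) < u q y) → u l y ≤ u l x := by
    intro l
    obtain ⟨x, hx, hx2⟩ := Finset.exists_max_image
      (univ.filter fun y => ∀ q, q ≠ l → u q (m q) < u q y) (u l)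
      ⟨s l, by simp only [mem_filter, mem_univ, true_and]; intro q hq; exact (h2 q v hvτ).trans_lt (hv q l hq)⟩
    simp only [mem_filter, mem_univ, true_and] at hx hx2
    exact ⟨x, hx, hx2⟩
  choose X hX1 hX2 using hY
  have good : ∀ l, (∃ q, q ≠ l ∧ m q = m l) → X l ∉ τ ∧ ScDom u (insert (X l) τ) := by
    rintro l ⟨r, hrl, hr⟩
    constructor
    · intro hx
      obtain ⟨q, hq⟩ := hs _ hx
      by_cases hql : q = l
      · have := hX1 l r hrl
        rw [hr, ← hql, hq, hql] at this
        exact lt_irrefl _ this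
      · have := hX1 l q hql
        rw [hq] at this
        exact lt_irrefl _ this
    · intro y
      by_cases hy : ∀ q, q ≠ l → u q (m q) < u q y
      · refine ⟨l, ?_⟩
        intro x hx
        rcases Finset.mem_insert.1 hx with rfl | hx
        · exact hX2 l y hy
        · obtain ⟨p, hp⟩ := hD y
          by_cases hpl : p = l
          · exact hpl ▸ hp x hx
          · exact absurd (hy p hpl) (not_lt.2 (hp _ (h1 p)))
      · push Not at hy
        obtain ⟨q, hql, hq⟩ := hy
        refine ⟨q, ?_⟩
        intro x hx
        rcases Finset.mem_insert.1 hx with rfl | hx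
        · exact hq.trans (hX1 l q hql).le
        · exact hq.trans (h2 q x hx)
  have hne : X i ≠ X j := by
    intro h
    obtain ⟨q, hq⟩ := hD (X i)
    have h3 := hq _ (h1 q)
    by_cases hqi : q = i
    · have := hX1 j q (by rw [hqi]; exact hij)
      rw [← h] at this; omega
    · have := hX1 i q hqi
      omega
  have hset : (univ.filter fun x => x ∉ τ ∧ ScDom u (insert x τ)) = {X i, X j} := by
    ext x
    simp only [mem_filter, mem_univ, true_and, mem_insert, mem_singleton]
    constructor
    · rintro ⟨hxτ, hxD⟩
      obtain ⟨m', h1', h2'⟩ := sc_min u (insert x τ) ⟨x, by simp⟩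
      have hs' := sc_surj u hu _ hxD m' h1' h2'
      obtain ⟨l, hl⟩ := hs' x (by simp)
      have himg' : univ.image m' = insert x τ := by
        ext x; simp only [mem_image, mem_univ, true_and]
        exact ⟨fun ⟨i, hi⟩ => hi ▸ h1' i, hs' x⟩
      have hinj : Set.InjOn m' (univ : Finset I) := by
        apply Finset.injOn_of_card_image_eq
        rw [himg', Finset.card_insert_of_notMem hxτ, hcard, Finset.card_univ]
      have hxY : ∀ q, q ≠ l → u q (m q) < u q x := by
        intro q hq
        by_contra hlt
        apply hq
        apply hinj (by simp) (by simp)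
        rw [hl]
        apply hu q
        apply le_antisymm (h2' q x (by simp))
        push Not at hlt
        rcases Finset.mem_insert.1 (h1' q) with h | h
        · rw [h]
        · exact hlt.trans (h2 q _ h)
      have hmax : ∀ y, (∀ q, q ≠ l → u q (m q) < u q y) → u l y ≤ u l x := by
        intro y hy
        obtain ⟨q, hq⟩ := hxD y
        by_cases hql : q = l
        · exact hql ▸ hq x (by simp)
        · exact absurd (hy q hql) (not_lt.2 (hq _ (by simp [h1 q])))
      have hxX : x = X l := hu l (le_antisymm (hX2 l x hxY) (hmax _ (hX1 l)))
      obtain ⟨r, hr⟩ := hs' (m l) (by simp [h1 l])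
      have hrl : r ≠ l := by
        rintro rfl
        rw [hl] at hr
        exact hxτ (hr ▸ h1 r)
      have hmr : m r = m l := by
        apply hu r
        apply le_antisymm (h2 r _ (h1 l))
        rw [← hr]; exact h2' r _ (by simp [h1 r])
      rcases huniq r (mem_univ _) l (mem_univ _) hrl hmr with h | h
      · right; rw [hxX, h.2]
      · left; rw [hxX, h.2]
    · rintro (rfl | rfl)
      · exact good i ⟨j, hij.symm, hm.symm⟩
      · exact good j ⟨i, hij, hm⟩
  rw [hset, Finset.card_pair hne]

theorem sc_outer {V I : Type*} [Fintype V] [DecidableEq V] [Fintype I] [DecidableEq I]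
    (u : I → V → ℕ) (hu : ∀ i, Function.Injective (u i)) (s : I → V) (hsinj : Function.Injective s)
    (hs1 : ∀ i v, u i (s i) ≤ u i v)
    (hs2 : ∀ i q v, q ≠ i → v ∉ Set.range s → u i v < u i (s q)) (i0 : I)
    [DecidablePred fun x => x ∉ (univ.erase i0).image s ∧ ScDom u (insert x ((univ.erase i0).image s))] :
    (univ.filter fun x => x ∉ (univ.erase i0).image s ∧ ScDom u (insert x ((univ.erase i0).image s))).card = 1 := by
  set τ := (univ.erase i0).image s with hτ
  have hmem : ∀ q, q ≠ i0 → s q ∈ τ := by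
    intro q hq; simp only [hτ, mem_image]; exact ⟨q, by simp [hq], rfl⟩
  have hmem' : ∀ x ∈ τ, ∃ q, q ≠ i0 ∧ s q = x := by
    intro x hx; simp only [hτ, mem_image] at hx
    obtain ⟨q, hq, rfl⟩ := hx; exact ⟨q, by simpa using hq, rfl⟩
  obtain ⟨x, hx, hx2⟩ := Finset.exists_max_image (univ.filter fun y => y ∉ τ) (u i0)
    ⟨s i0, by
      simp only [mem_filter, mem_univ, true_and]; intro h
      obtain ⟨q, hq, h⟩ := hmem' _ h; exact hq (hsinj h)⟩
  simp only [mem_filter, mem_univ, true_and] at hx hx2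
  rw [Finset.card_eq_one]
  refine ⟨x, ?_⟩
  ext y
  simp only [mem_filter, mem_univ, true_and, mem_singleton]
  constructor
  · rintro ⟨hy, hyD⟩
    apply hu i0
    apply le_antisymm (hx2 y hy)
    obtain ⟨q, hq⟩ := hyD x
    by_cases hqi : q = i0
    · exact hqi ▸ hq y (by simp)
    · exfalso
      have := hq (s q) (Finset.mem_insert_of_mem (hmem q hqi))
      have h3 : x = s q := hu q (le_antisymm this (hs1 q x))
      exact hx (h3 ▸ hmem q hqi)
  · rintro rfl
    refine ⟨hx, ?_⟩
    intro z
    by_cases hz : z ∈ τ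
    · obtain ⟨q, hq, rfl⟩ := hmem' z hz
      exact ⟨q, fun x _ => hs1 q x⟩
    · refine ⟨i0, ?_⟩
      intro w hw
      rcases Finset.mem_insert.1 hw with rfl | hw
      · exact hx2 z hz
      · obtain ⟨q, hq, rfl⟩ := hmem' w hw
        by_cases hzr : z ∈ Set.range s
        · obtain ⟨r, rfl⟩ := hzr
          by_cases hr : r = i0
          · rw [hr]; exact hs1 _ _
          · exact absurd (hmem r hr) hz
        · exact (hs2 i0 q z hq hzr).le

theorem sc_main {V I : Type*} [Fintype V] [DecidableEq V] [Fintype I] [DecidableEq I]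
    (u : I → V → ℕ) (hu : ∀ i, Function.Injective (u i)) (s : I → V) (c : V → I)
    (hc : ∀ i, c (s i) = i)
    (hs1 : ∀ i v, u i (s i) ≤ u i v)
    (hs2 : ∀ i q v, q ≠ i → v ∉ Set.range s → u i v < u i (s q)) (i0 : I) :
    ∃ S : Finset V, ScDom u S ∧ S.image c = univ := by
  classical
  have hsinj : Function.Injective s := fun a b h => by rw [← hc a, h, hc]
  by_contra hno
  push Not at hno
  set R : Finset (Finset V) := univ.filter fun S => S.card = Fintype.card I ∧ ScDom u S with hR
  set D : Finset (Finset V) := univ.filter fun τ => τ.image c = univ.erase i0 ∧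
    τ.card + 1 = Fintype.card I ∧ ScDom u τ with hDD
  have hcardpos : 0 < Fintype.card I := Fintype.card_pos_iff.2 ⟨i0⟩
  have hdc := Finset.sum_card_bipartiteAbove_eq_sum_card_bipartiteBelow (s := R) (t := D)
    (fun S τ => τ ⊆ S)
  have hleft : Even (∑ S ∈ R, (D.bipartiteAbove (fun S τ => τ ⊆ S) S).card) := by
    apply Finset.even_sum
    intro S hS
    simp only [hR, mem_filter, mem_univ, true_and] at hS
    by_cases hemp : (D.bipartiteAbove (fun S τ => τ ⊆ S) S) = ∅
    · rw [hemp]; simp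
    obtain ⟨τ, hτ⟩ := Finset.nonempty_iff_ne_empty.2 hemp
    simp only [Finset.mem_bipartiteAbove, hDD, mem_filter, mem_univ, true_and] at hτ
    have hSi : S.image c = univ.erase i0 := by
      have h1 : univ.erase i0 ⊆ S.image c := by
        rw [← hτ.1.1]; exact Finset.image_subset_image hτ.2
      by_contra hne
      apply hno S hS.2
      ext x
      simp only [mem_univ, iff_true]
      by_cases hx : x = i0
      · by_contra hx2
        apply hne
        apply Finset.Subset.antisymm _ h1
        intro y hy
        simp only [mem_erase, mem_univ, and_true]
        rintro rfl; exact hx2 (hx ▸ hy)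
      · exact h1 (by simp [hx])
    obtain ⟨a, ha, b, hb, hab, hf, huniq⟩ := sc_pigeon c S (by
      rw [hSi, Finset.card_erase_of_mem (mem_univ _), Finset.card_univ, hS.1]; omega)
    have hset : (D.bipartiteAbove (fun S τ => τ ⊆ S) S) = {S.erase a, S.erase b} := by
      ext σ
      simp only [Finset.mem_bipartiteAbove, hDD, mem_filter, mem_univ, true_and, mem_insert,
        mem_singleton]
      constructor
      · rintro ⟨⟨h1, h2, h3⟩, h4⟩
        have h5 : a ∉ σ ∨ b ∉ σ := by
          by_contra h6
          push Not at h6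
          have : Set.InjOn c σ := by
            apply Finset.injOn_of_card_image_eq
            rw [h1, Finset.card_erase_of_mem (mem_univ _), Finset.card_univ]; omega
          exact hab (this h6.1 h6.2 hf)
        rcases h5 with h5 | h5
        · left
          apply Finset.eq_of_subset_of_card_le (Finset.subset_erase.2 ⟨h4, h5⟩)
          rw [Finset.card_erase_of_mem ha]; omega
        · right
          apply Finset.eq_of_subset_of_card_le (Finset.subset_erase.2 ⟨h4, h5⟩)
          rw [Finset.card_erase_of_mem hb]; omega
      · have gen : ∀ a ∈ S, ∀ b ∈ S, a ≠ b → c a = c b →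
            ((S.erase a).image c = univ.erase i0 ∧ (S.erase a).card + 1 = Fintype.card I ∧
              ScDom u (S.erase a)) ∧ S.erase a ⊆ S := by
          intro a ha b hb hab hf
          refine ⟨⟨?_, ?_, ?_⟩, Finset.erase_subset _ _⟩
          · rw [← hSi]
            apply Finset.Subset.antisymm (Finset.image_subset_image (Finset.erase_subset _ _))
            intro y hy
            obtain ⟨w, hw, rfl⟩ := Finset.mem_image.1 hy
            by_cases hwa : w = a
            · rw [hwa, hf]; exact Finset.mem_image_of_mem _ (by simp [hb, hab.symm])
            · exact Finset.mem_image_of_mem _ (by simp [hw, hwa])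
          · rw [Finset.card_erase_of_mem ha]; omega
          · intro y
            obtain ⟨i, hi⟩ := hS.2 y
            exact ⟨i, fun x hx => hi x (Finset.mem_of_mem_erase hx)⟩
        rintro (rfl | rfl)
        · exact gen a ha b hb hab hf
        · exact gen b hb a ha hab.symm hf.symm
    rw [hset, Finset.card_pair]
    · exact even_two
    · intro h
      have : a ∈ S.erase b := by simp [ha, hab]
      rw [← h] at this; simp at this
  have hcnt : ∀ τ ∈ D, (R.bipartiteBelow (fun S τ => τ ⊆ S) τ).card =
      (univ.filter fun x => x ∉ τ ∧ ScDom u (insert x τ)).card := by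
    intro τ hτ
    simp only [hDD, mem_filter, mem_univ, true_and] at hτ
    symm
    apply Finset.card_bij (fun x _ => insert x τ)
    · intro x hx
      simp only [mem_filter, mem_univ, true_and] at hx
      simp only [Finset.mem_bipartiteBelow, hR, mem_filter, mem_univ, true_and]
      refine ⟨⟨?_, hx.2⟩, Finset.subset_insert _ _⟩
      rw [Finset.card_insert_of_notMem hx.1, hτ.2.1]
    · intro x hx y hy hxy
      simp only [mem_filter, mem_univ, true_and] at hx hy
      have : x ∈ insert y τ := by rw [← hxy]; simp
      rcases Finset.mem_insert.1 this with h | h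
      · exact h
      · exact absurd h hx.1
    · intro S hS
      simp only [Finset.mem_bipartiteBelow, hR, mem_filter, mem_univ, true_and] at hS
      have : (S \ τ).card = 1 := by
        rw [Finset.card_sdiff_of_subset hS.2]; omega
      obtain ⟨x, hx⟩ := Finset.card_eq_one.1 this
      have hxS : x ∈ S \ τ := by rw [hx]; simp
      have hins : insert x τ = S := by
        rw [Finset.insert_eq, ← hx, Finset.sdiff_union_of_subset hS.2]
      refine ⟨x, ?_, hins⟩
      simp only [mem_filter, mem_univ, true_and]
      rw [hins]
      exact ⟨(Finset.mem_sdiff.1 hxS).2, hS.1.2⟩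
  have hO : (univ.erase i0).image s ∈ D := by
    simp only [hDD, mem_filter, mem_univ, true_and]
    refine ⟨?_, ?_, ?_⟩
    · rw [Finset.image_image]
      have : c ∘ s = id := by ext i; simp [hc]
      rw [this, Finset.image_id]
    · rw [Finset.card_image_of_injective _ hsinj, Finset.card_erase_of_mem (mem_univ _),
        Finset.card_univ]; omega
    · intro y
      by_cases hy : y ∈ Set.range s
      · obtain ⟨q, rfl⟩ := hy
        exact ⟨q, fun x _ => hs1 q x⟩
      · refine ⟨i0, fun x hx => ?_⟩
        obtain ⟨q, hq, rfl⟩ := Finset.mem_image.1 hx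
        exact (hs2 i0 q y (by simpa using hq) hy).le
  rw [← Finset.add_sum_erase D _ hO, hcnt _ hO, sc_outer u hu s hsinj hs1 hs2 i0] at hdc
  have hright : Even (∑ τ ∈ D.erase ((univ.erase i0).image s),
      (R.bipartiteBelow (fun S τ => τ ⊆ S) τ).card) := by
    apply Finset.even_sum
    intro τ hτ'
    have hτD := Finset.mem_of_mem_erase hτ'
    have hτ := hτD
    simp only [hDD, mem_filter, mem_univ, true_and] at hτ
    rw [hcnt τ hτD, sc_door u hu s τ hτ.2.2 hτ.2.1]
    · exact even_two
    · by_contra hnv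
      apply (Finset.mem_erase.1 hτ').1
      have hsub : τ ⊆ (univ.erase i0).image s := by
        intro v hv
        by_contra hv2
        apply hnv
        refine ⟨v, hv, fun q l hql => hs2 q l v hql.symm ?_⟩
        rintro ⟨r, rfl⟩
        apply hv2
        apply Finset.mem_image_of_mem
        have : c (s r) ∈ τ.image c := Finset.mem_image_of_mem _ hv
        rw [hτ.1, hc] at this
        exact this
      apply Finset.eq_of_subset_of_card_le hsub
      rw [Finset.card_image_of_injective _ hsinj, Finset.card_erase_of_mem (mem_univ _),
        Finset.card_univ]; omega
  rw [hdc] at hleft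
  rw [Nat.even_add] at hleft
  exact absurd (hleft.2 hright) (by decide)
theorem sc_enc {M a b p q : ℕ} (_hp : p < M) (hq : q < M) (h : a * M + p ≤ b * M + q) : a ≤ b := by
  by_contra hlt
  push Not at hlt
  have : (b + 1) * M ≤ a * M := Nat.mul_le_mul_right M hlt
  rw [Nat.add_mul, one_mul] at this
  omega

theorem sc_grid {I : Type*} [Fintype I] [DecidableEq I] (N : ℕ) (i0 : I) (c : (I → ℕ) → I) :
    ∃ x : I → ℕ, ∑ i, x i = N ∧ ∃ C : Finset I, (∀ i, i ∉ C → x i ≤ Fintype.card I) ∧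
      ∀ i ∈ C, ∃ w : I → ℕ, ∑ i, w i = N ∧ c w = i ∧
        ∀ l, x l ≤ w l + Fintype.card I ∧ w l ≤ x l + Fintype.card I := by
  classical
  let T := {y : I → Fin (N + 1) // ∑ i, (y i : ℕ) = N}
  have mkT : ∀ y : I → ℕ, ∑ i, y i = N → ∃ t : T, ∀ i, (t.1 i : ℕ) = y i := by
    intro y hy
    have hle : ∀ i, y i < N + 1 := by
      intro i
      have := Finset.single_le_sum (f := y) (fun i _ => Nat.zero_le _) (mem_univ i)
      omega
    exact ⟨⟨fun i => ⟨y i, hle i⟩, by simpa using hy⟩, fun i => rfl⟩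
  let M := Fintype.card T
  let enc : T ≃ Fin M := Fintype.equivFin T
  let encI : I ≃ Fin (Fintype.card I) := Fintype.equivFin I
  let u : I → T ⊕ I → ℕ := fun i v => match v with
    | Sum.inl y => 1 + ((y.1 i : ℕ) * M + enc y)
    | Sum.inr q => if q = i then 0 else 1 + ((N + 1) * M + encI q)
  have hub : ∀ i (y : T), (y.1 i : ℕ) * M + enc y < (N + 1) * M := by
    intro i y
    have h1 := (enc y).2
    have h2 : ((y.1 i : ℕ) + 1) * M ≤ (N + 1) * M := Nat.mul_le_mul_right M (y.1 i).2
    rw [Nat.add_mul, one_mul] at h2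
    omega
  have hu : ∀ i, Function.Injective (u i) := by
    intro i a b hab
    rcases a with a | a <;> rcases b with b | b <;> simp only [u] at hab
    · have h1 := (enc a).2
      have h2 := (enc b).2
      have h3 := sc_enc h1 h2 (by omega : (a.1 i : ℕ) * M + enc a ≤ (b.1 i : ℕ) * M + enc b)
      have h4 := sc_enc h2 h1 (by omega : (b.1 i : ℕ) * M + enc b ≤ (a.1 i : ℕ) * M + enc a)
      have h5 : (a.1 i : ℕ) = b.1 i := le_antisymm h3 h4
      rw [h5] at hab
      have : enc a = enc b := Fin.ext (by omega)
      rw [enc.injective this]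
    · have := hub i a
      split_ifs at hab <;> omega
    · have := hub i b
      split_ifs at hab <;> omega
    · split_ifs at hab with h1 h2 h2
      · rw [h1, h2]
      · omega
      · omega
      · have : encI a = encI b := Fin.ext (by omega)
        rw [encI.injective this]
  let c' : T ⊕ I → I := fun v => match v with
    | Sum.inl y => c (fun i => (y.1 i : ℕ))
    | Sum.inr q => q
  obtain ⟨S, hSD, hSc⟩ := sc_main u hu Sum.inr c' (fun i => rfl)
    (by intro i v; simp [u])
    (by
      intro i q v hq hv
      rcases v with v | v
      · have := hub i v
        simp only [u, if_neg hq]; omega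
      · exact absurd ⟨v, rfl⟩ hv) i0
  let C : Finset I := univ.filter fun i => Sum.inr i ∉ S
  have hdom : ∀ y : T, ∃ i ∈ C, ∀ x : T, Sum.inl x ∈ S → (y.1 i : ℕ) ≤ x.1 i := by
    intro y
    obtain ⟨i, hi⟩ := hSD (Sum.inl y)
    refine ⟨i, ?_, ?_⟩
    · simp only [C, mem_filter, mem_univ, true_and]
      intro h
      have := hi _ h
      simp [u] at this
    · intro x hx
      have := hi _ hx
      simp only [u] at this
      exact sc_enc (enc y).2 (enc x).2 (by omega)
  have hcol : ∀ i ∈ C, ∃ x : T, Sum.inl x ∈ S ∧ c (fun i => (x.1 i : ℕ)) = i := by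
    intro i hi
    simp only [C, mem_filter, mem_univ, true_and] at hi
    have : i ∈ S.image c' := by rw [hSc]; simp
    obtain ⟨v, hv, hvi⟩ := Finset.mem_image.1 this
    rcases v with v | v
    · exact ⟨v, hv, hvi⟩
    · simp only [c'] at hvi
      exact absurd (hvi ▸ hv) hi
  obtain ⟨t0, -⟩ := mkT (fun i => if i = i0 then N else 0) (by simp)
  obtain ⟨i1, hi1, -⟩ := hdom t0
  obtain ⟨x0, hx0, -⟩ := hcol i1 hi1
  have hmin : ∀ i, ∃ m : ℕ, (∃ x : T, Sum.inl x ∈ S ∧ (x.1 i : ℕ) = m) ∧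
      ∀ x : T, Sum.inl x ∈ S → m ≤ x.1 i := by
    intro i
    obtain ⟨x, hx, hx2⟩ := Finset.exists_min_image (univ.filter fun x : T => Sum.inl x ∈ S)
      (fun x => (x.1 i : ℕ)) ⟨x0, by simpa using hx0⟩
    simp only [mem_filter, mem_univ, true_and] at hx hx2
    exact ⟨x.1 i, ⟨x, hx, rfl⟩, hx2⟩
  choose m hm1 hm2 using hmin
  have hsum : N < ∑ i ∈ C, (m i + 1) := by
    by_contra hle
    push Not at hle
    obtain ⟨y, hy⟩ := mkT (fun i => (if i ∈ C then m i + 1 else 0) +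
      (if i = i1 then N - ∑ i ∈ C, (m i + 1) else 0)) (by
        rw [Finset.sum_add_distrib]
        simp only [Finset.sum_ite_mem, Finset.univ_inter, Finset.sum_ite_eq', mem_univ, if_true]
        omega)
    obtain ⟨i, hi, hi2⟩ := hdom y
    obtain ⟨x, hx, hxm⟩ := hm1 i
    have := hi2 x hx
    rw [hy, hxm, if_pos hi] at this
    omega
  rw [Finset.sum_add_distrib, Finset.sum_const, smul_eq_mul, mul_one] at hsum
  have hCc : C.card ≤ Fintype.card I := Finset.card_le_univ C
  have hx1 : ∀ x : T, Sum.inl x ∈ S → ∀ i ∈ C, (x.1 i : ℕ) ≤ m i + Fintype.card I := by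
    intro x hx i hi
    have h1 : ∑ l ∈ C, (x.1 l : ℕ) ≤ N := by
      conv_rhs => rw [← x.2]
      exact Finset.sum_le_sum_of_subset (Finset.subset_univ C)
    rw [← Finset.add_sum_erase C _ hi] at h1
    rw [← Finset.add_sum_erase C m hi] at hsum
    have h2 : ∑ l ∈ C.erase i, m l ≤ ∑ l ∈ C.erase i, (x.1 l : ℕ) :=
      Finset.sum_le_sum fun l _ => hm2 l x hx
    omega
  have hx2 : ∀ x : T, Sum.inl x ∈ S → ∀ i, i ∉ C → (x.1 i : ℕ) ≤ Fintype.card I := by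
    intro x hx i hi
    have h1 : ∑ l ∈ insert i C, (x.1 l : ℕ) ≤ N := by
      conv_rhs => rw [← x.2]
      exact Finset.sum_le_sum_of_subset (Finset.subset_univ _)
    rw [Finset.sum_insert hi] at h1
    have h2 : ∑ l ∈ C, m l ≤ ∑ l ∈ C, (x.1 l : ℕ) :=
      Finset.sum_le_sum fun l _ => hm2 l x hx
    omega
  have hx3 : ∀ x w : T, Sum.inl x ∈ S → Sum.inl w ∈ S → ∀ l,
      (x.1 l : ℕ) ≤ w.1 l + Fintype.card I := by
    intro x w hx hw l
    by_cases hl : l ∈ C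
    · have := hx1 x hx l hl
      have := hm2 l w hw
      omega
    · have := hx2 x hx l hl
      omega
  refine ⟨fun i => (x0.1 i : ℕ), x0.2, C, hx2 x0 hx0, ?_⟩
  intro i hi
  obtain ⟨w, hw, hwi⟩ := hcol i hi
  exact ⟨fun i => (w.1 i : ℕ), w.2, hwi, fun l => ⟨hx3 x0 w hx0 hw l, hx3 w x0 hw hx0 l⟩⟩

theorem sc_kkm {I : Type*} [Fintype I] [DecidableEq I] (i0 : I) (Q : I → Set (I → ℝ))
    (hQ : ∀ i, IsClosed (Q i)) (hcov : ∀ z ∈ stdSimplex ℝ I, ∃ i, z ∈ Q i) :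
    ∃ z ∈ stdSimplex ℝ I, ∀ i, 0 < z i → z ∈ Q i := by
  classical
  have step : ∀ N : ℕ, ∃ z ∈ stdSimplex ℝ I, ∀ i, z i ≤ (Fintype.card I : ℝ) / (N + 1) ∨
      ∃ w ∈ Q i, dist z w ≤ (Fintype.card I : ℝ) / (N + 1) := by
    intro N
    have hN : (0 : ℝ) < N + 1 := by positivity
    have hsimp : ∀ y : I → ℕ, ∑ i, y i = N + 1 → (fun i => (y i : ℝ) / (N + 1)) ∈ stdSimplex ℝ I := by
      intro y hy
      refine ⟨fun i => by positivity, ?_⟩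
      rw [← Finset.sum_div, ← Nat.cast_sum, hy]
      push_cast
      field_simp
    have : ∀ y : I → ℕ, ∃ i, ∑ i, y i = N + 1 → (fun i => (y i : ℝ) / (N + 1)) ∈ Q i := by
      intro y
      by_cases hy : ∑ i, y i = N + 1
      · obtain ⟨i, hi⟩ := hcov _ (hsimp y hy)
        exact ⟨i, fun _ => hi⟩
      · exact ⟨i0, fun h => absurd h hy⟩
    choose c hc using this
    obtain ⟨x, hx, C, hC1, hC2⟩ := sc_grid (N + 1) i0 c
    refine ⟨_, hsimp x hx, fun i => ?_⟩
    by_cases hi : i ∈ C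
    · right
      obtain ⟨w, hw, hwi, hd⟩ := hC2 i hi
      refine ⟨_, hwi ▸ hc w hw, ?_⟩
      rw [dist_pi_le_iff (by positivity)]
      intro l
      rw [Real.dist_eq, ← sub_div, abs_div, abs_of_pos hN]
      apply div_le_div_of_nonneg_right _ hN.le
      obtain ⟨h1, h2⟩ := hd l
      have h1' : (x l : ℝ) ≤ w l + Fintype.card I := by exact_mod_cast h1
      have h2' : (w l : ℝ) ≤ x l + Fintype.card I := by exact_mod_cast h2
      rw [abs_le]; constructor <;> linarith
    · left
      apply div_le_div_of_nonneg_right _ hN.le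
      exact_mod_cast hC1 i hi
  choose z hz1 hz2 using step
  obtain ⟨a, ha, φ, hφ, hlim⟩ := (isCompact_stdSimplex ℝ I).tendsto_subseq hz1
  refine ⟨a, ha, fun i hi => ?_⟩
  have he : Filter.Tendsto (fun N : ℕ => (Fintype.card I : ℝ) / ((N : ℝ) + 1)) Filter.atTop (nhds 0) := by
    have := (tendsto_one_div_add_atTop_nhds_zero_nat (𝕜 := ℝ)).const_mul (Fintype.card I : ℝ)
    simpa [div_eq_mul_inv] using this
  have he' := he.comp hφ.tendsto_atTop
  rw [← (hQ i).closure_eq, Metric.mem_closure_iff]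
  intro ε hε
  have hzi : Filter.Tendsto (fun N => z (φ N) i) Filter.atTop (nhds (a i)) :=
    (tendsto_pi_nhds.1 hlim) i
  have e1 := hzi.eventually (lt_mem_nhds (show a i / 2 < a i by linarith))
  have e2 := he'.eventually (gt_mem_nhds (show (0 : ℝ) < min (a i / 2) (ε / 2) by positivity))
  have e3 := (Metric.tendsto_nhds.1 hlim) (ε / 2) (by positivity)
  obtain ⟨N, h1, h2, h3⟩ := (e1.and (e2.and e3)).exists
  simp only [Function.comp] at h2 h3
  have h4 := lt_of_lt_of_le h2 (min_le_left _ _)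
  have h5 := lt_of_lt_of_le h2 (min_le_right _ _)
  rcases hz2 (φ N) i with h | ⟨w, hw, hd⟩
  · linarith
  · refine ⟨w, hw, ?_⟩
    have := dist_triangle a (z (φ N)) w
    rw [dist_comm a (z (φ N))] at this
    linarith
theorem sc_vi (n k : ℕ) (hn : 0 < n) (hk : 0 < k)
    (F : (Fin k → Fin n → ℝ) → Fin k → Fin n → ℝ) (hF : Continuous F) :
    ∃ x : Fin k → Fin n → ℝ, (∀ j, x j ∈ stdSimplex ℝ (Fin n)) ∧
      ∀ j i i', 0 < x j i → F x j i' ≤ F x j i := by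
  have hkR : (0 : ℝ) < 1 / k := by positivity
  have hnR : (0 : ℝ) < n := by positivity
  let s : (Fin k × Fin n → ℝ) → Fin k → ℝ := fun y j => ∑ i, y (j, i)
  let r : (Fin k × Fin n → ℝ) → Fin k → Fin n → ℝ := fun y j i =>
    (y (j, i) + max 0 (1 / k - s y j) / n) / max (s y j) (1 / k)
  have hs : ∀ j, Continuous fun y => s y j := by
    intro j; simp only [s]; fun_prop
  have hr : Continuous r := by
    refine continuous_pi fun j => continuous_pi fun i => ?_
    have := hs j
    apply Continuous.div
    · fun_prop
    · fun_prop
    · intro y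
      exact (lt_of_lt_of_le hkR (le_max_right _ _)).ne'
  have hFr : ∀ j i, Continuous fun y => F (r y) j i := by
    intro j i
    exact (continuous_apply i).comp ((continuous_apply j).comp (hF.comp hr))
  let Q : Fin k × Fin n → Set (Fin k × Fin n → ℝ) := fun p =>
    {y | s y p.1 ≤ 1 / k} ∩ ⋂ i', {y | F (r y) p.1 i' ≤ F (r y) p.1 p.2}
  have hQ : ∀ p, IsClosed (Q p) := by
    intro p
    exact (isClosed_le (hs _) continuous_const).inter
      (isClosed_iInter fun i' => isClosed_le (hFr _ _) (hFr _ _))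
  have htot : ∀ z ∈ stdSimplex ℝ (Fin k × Fin n), ∑ j, s z j = 1 := by
    intro z hz
    rw [← hz.2, Fintype.sum_prod_type]
  have hk1 : ∑ _j : Fin k, (1 / k : ℝ) = 1 := by
    simp; field_simp
  obtain ⟨z, hz, hzQ⟩ := sc_kkm ((⟨0, hk⟩, ⟨0, hn⟩) : Fin k × Fin n) Q hQ (by
    intro z hz
    have : ∃ j, s z j ≤ 1 / k := by
      by_contra hlt
      push Not at hlt
      have : ∑ _j : Fin k, (1 / k : ℝ) < ∑ j, s z j :=
        Finset.sum_lt_sum_of_nonempty ⟨⟨0, hk⟩, mem_univ _⟩ (fun j _ => hlt j)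
      rw [htot z hz, hk1] at this
      exact lt_irrefl _ this
    obtain ⟨j, hj⟩ := this
    obtain ⟨i, -, hi⟩ := Finset.exists_max_image univ (F (r z) j) ⟨⟨0, hn⟩, mem_univ _⟩
    exact ⟨(j, i), hj, by simpa using hi⟩)
  have hle : ∀ j, s z j ≤ 1 / k := by
    intro j
    by_cases h : ∃ i, 0 < z (j, i)
    · obtain ⟨i, hi⟩ := h
      exact (hzQ (j, i) hi).1
    · push Not at h
      exact (Finset.sum_nonpos fun i _ => h i).trans hkR.le
  have heq : ∀ j, s z j = 1 / k := by
    have := (Finset.sum_eq_sum_iff_of_le (s := univ) (fun j _ => hle j)).1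
      (by rw [htot z hz, hk1])
    exact fun j => this j (mem_univ _)
  refine ⟨r z, ?_, ?_⟩
  · intro j
    refine ⟨fun i => ?_, ?_⟩
    · have := hz.1 (j, i)
      simp only [r, heq, max_self, sub_self, zero_div, add_zero]
      positivity
    · simp only [r, heq, max_self, sub_self, zero_div, add_zero]
      rw [← Finset.sum_div]
      change s z j / _ = 1
      rw [heq]; field_simp
  · intro j i i' hpos
    have hzpos : 0 < z (j, i) := by
      simp only [r, heq, max_self, sub_self, zero_div, add_zero] at hpos
      rcases (hz.1 (j, i)).lt_or_eq with h | h
      · exact h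
      · rw [← h] at hpos; simp at hpos
    have := (hzQ (j, i) hzpos).2
    simp only [Set.mem_iInter, Set.mem_ofPred_eq] at this
    exact this i'

noncomputable def scPsi {J : Type*} [Fintype J] (m : J → ℤ) (x : J → ℝ) : ℝ :=
  (∏ i, max 0 (1 - |(m i : ℝ) - x i|)) *
    ∏ i, ∏ i', max 0 (1 - ((m i : ℝ) - x i) + ((m i' : ℝ) - x i'))

theorem scPsi_cont {J : Type*} [Fintype J] (m : J → ℤ) : Continuous (scPsi m) := by
  unfold scPsi; fun_prop

theorem scPsi_nonneg {J : Type*} [Fintype J] (m : J → ℤ) (x : J → ℝ) : 0 ≤ scPsi m x := by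
  unfold scPsi
  exact mul_nonneg (Finset.prod_nonneg fun i _ => le_max_left _ _)
    (Finset.prod_nonneg fun i _ => Finset.prod_nonneg fun i' _ => le_max_left _ _)

theorem scPsi_pos {J : Type*} [Fintype J] (m : J → ℤ) (x : J → ℝ) :
    0 < scPsi m x ↔ (∀ i, |(m i : ℝ) - x i| < 1) ∧
      ∀ i i', ((m i : ℝ) - x i) - ((m i' : ℝ) - x i') < 1 := by
  constructor
  · intro h
    unfold scPsi at h
    have h0 := left_ne_zero_of_mul h.ne'
    have h1 := right_ne_zero_of_mul h.ne'
    rw [Finset.prod_ne_zero_iff] at h0 h1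
    refine ⟨fun i => ?_, fun i i' => ?_⟩
    · by_contra hc
      exact h0 i (mem_univ _) (max_eq_left (by linarith))
    · by_contra hc
      have := h1 i (mem_univ _)
      rw [Finset.prod_ne_zero_iff] at this
      exact this i' (mem_univ _) (max_eq_left (by linarith))
  · rintro ⟨h1, h2⟩
    unfold scPsi
    refine mul_pos (Finset.prod_pos fun i _ => ?_)
      (Finset.prod_pos fun i _ => Finset.prod_pos fun i' _ => ?_)
    · exact lt_max_of_lt_right (by linarith [h1 i])
    · exact lt_max_of_lt_right (by linarith [h2 i i'])

theorem scPsi_floor {J : Type*} [Fintype J] (x : J → ℝ) : 0 < scPsi (fun i => ⌊x i⌋) x := by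
  rw [scPsi_pos]
  refine ⟨fun i => ?_, fun i i' => ?_⟩
  · have h1 := Int.floor_le (x i)
    have h2 := Int.lt_floor_add_one (x i)
    rw [abs_lt]; constructor <;> linarith
  · have h1 := Int.floor_le (x i)
    have h2 := Int.lt_floor_add_one (x i')
    linarith

theorem scPsi_color {J : Type*} [Fintype J] (d : ℕ) (hd : Fintype.card J = d) (m m' : J → ℤ)
    (x : J → ℝ) (h : 0 < scPsi m x) (h' : 0 < scPsi m' x)
    (hc : ((∑ i, m i : ℤ) : ZMod (d + 1)) = ((∑ i, m' i : ℤ) : ZMod (d + 1))) : m = m' := by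
  -- one-sided version
  have key : ∀ m m' : J → ℤ, 0 < scPsi m x → 0 < scPsi m' x →
      ((∑ i, m i : ℤ) : ZMod (d + 1)) = ((∑ i, m' i : ℤ) : ZMod (d + 1)) →
      (∀ i, m i ≤ m' i) → m = m' := by
    intro m m' h h' hc hle
    rw [scPsi_pos] at h h'
    have hle1 : ∀ i, m' i ≤ m i + 1 := by
      intro i
      have h1 := abs_lt.1 (h.1 i)
      have h2 := abs_lt.1 (h'.1 i)
      have : (m' i : ℝ) < m i + 2 := by linarith
      have : m' i < m i + 2 := by exact_mod_cast this
      omega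
    rw [ZMod.intCast_eq_intCast_iff_dvd_sub] at hc
    have hs1 : ∑ i, m i ≤ ∑ i, m' i := Finset.sum_le_sum fun i _ => hle i
    have hs2 : ∑ i, m' i ≤ ∑ i, m i + d := by
      have := Finset.sum_le_sum (s := univ) fun i _ => hle1 i
      rw [Finset.sum_add_distrib] at this
      simpa [hd] using this
    have hz : ∑ i, m' i - ∑ i, m i = 0 := by
      apply Int.eq_zero_of_dvd_of_nonneg_of_lt (by omega) _ hc
      push_cast; omega
    have := (Finset.sum_eq_sum_iff_of_le (s := univ) (fun j _ => hle j)).1 (by omega)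
    exact funext fun j => this j (mem_univ _)
  by_cases hle : ∀ i, m i ≤ m' i
  · exact key m m' h h' hc hle
  · push Not at hle
    obtain ⟨i, hi⟩ := hle
    symm
    apply key m' m h' h hc.symm
    intro i'
    by_contra hlt
    push Not at hlt
    rw [scPsi_pos] at h h'
    have h1 := h.2 i i'
    have h2 := h'.2 i' i
    have h3 : (m' i : ℝ) + 1 ≤ m i := by exact_mod_cast hi
    have h4 : (m i' : ℝ) + 1 ≤ m' i' := by exact_mod_cast hlt
    linarith

theorem sc_approx (n k : ℕ) (hn : 0 < n) (hk : 0 < k)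
    (pref : ZMod (k * (n - 1) + 1) → (Fin k → Fin n → ℝ) → (Fin k → Fin n) → Prop)
    (hexists : ∀ a, ∀ x : Fin k → Fin n → ℝ,
      (∀ j, x j ∈ stdSimplex ℝ (Fin n)) → ∃ I : Fin k → Fin n, pref a x I) (N : ℕ) :
    ∃ (I : ZMod (k * (n - 1) + 1) → Fin k → Fin n) (x : Fin k → Fin n → ℝ)
      (lam : ZMod (k * (n - 1) + 1) → ℝ), (∀ j, x j ∈ stdSimplex ℝ (Fin n)) ∧
      lam ∈ stdSimplex ℝ (ZMod (k * (n - 1) + 1)) ∧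
      (∀ j i i', 0 < x j i → (∑ a, lam a * if I a j = i' then 1 else 0) ≤
        ∑ a, lam a * if I a j = i then 1 else 0) ∧
      ∀ a, 0 < lam a → ∃ y : Fin k → Fin n → ℝ, (∀ j, y j ∈ stdSimplex ℝ (Fin n)) ∧
        pref a y (I a) ∧ dist x y ≤ (n * 2) / ((N : ℝ) + 1) := by
  classical
  have hN : (0 : ℝ) < N + 1 := by positivity
  let z0 : Fin n := ⟨0, hn⟩
  let J := Fin k × {i : Fin n // i ≠ z0}
  have hJ : Fintype.card J = k * (n - 1) := by
    simp [J, Fintype.card_subtype_compl]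
  let T : (Fin k → Fin n → ℝ) → J → ℝ := fun x q => (N + 1) * x q.1 q.2.1
  have hT : Continuous T := by
    refine continuous_pi fun q => ?_
    simp only [T]; fun_prop
  let color : (J → ℤ) → ZMod (k * (n - 1) + 1) := fun m => ((∑ i, m i : ℤ) : ZMod _)
  let B : Finset (J → ℤ) := Fintype.piFinset fun _ => Finset.Icc (0 : ℤ) (N + 1)
  have hch : ∀ m : J → ℤ, ∃ (I : Fin k → Fin n) (y : Fin k → Fin n → ℝ),
      (∃ x : Fin k → Fin n → ℝ, (∀ j, x j ∈ stdSimplex ℝ (Fin n)) ∧ 0 < scPsi m (T x)) →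
      (∀ j, y j ∈ stdSimplex ℝ (Fin n)) ∧ 0 < scPsi m (T y) ∧ pref (color m) y I := by
    intro m
    by_cases h : ∃ x : Fin k → Fin n → ℝ, (∀ j, x j ∈ stdSimplex ℝ (Fin n)) ∧ 0 < scPsi m (T x)
    · obtain ⟨x, hx, hx2⟩ := h
      obtain ⟨I, hI⟩ := hexists (color m) x hx
      exact ⟨I, x, fun _ => ⟨hx, hx2, hI⟩⟩
    · exact ⟨fun _ => z0, fun _ _ => 0, fun h' => absurd h' h⟩
  choose Im Y hIY using hch
  let F : (Fin k → Fin n → ℝ) → Fin k → Fin n → ℝ := fun x j i =>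
    ∑ m ∈ B, scPsi m (T x) * if Im m j = i then 1 else 0
  have hF : Continuous F := by
    refine continuous_pi fun j => continuous_pi fun i => ?_
    refine continuous_finsetSum _ fun m _ => ?_
    exact ((scPsi_cont m).comp hT).mul continuous_const
  obtain ⟨x, hx, hvi⟩ := sc_vi n k hn hk F hF
  have hIs : ∀ a, ∃ I : Fin k → Fin n, ∀ m, 0 < scPsi m (T x) → color m = a → Im m = I := by
    intro a
    by_cases h : ∃ m, 0 < scPsi m (T x) ∧ color m = a
    · obtain ⟨m, hm, hma⟩ := h
      refine ⟨Im m, fun m' hm' hma' => ?_⟩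
      rw [scPsi_color _ hJ m' m (T x) hm' hm (hma'.trans hma.symm)]
    · exact ⟨fun _ => z0, fun m hm hma => absurd ⟨m, hm, hma⟩ h⟩
  choose I hI using hIs
  set W := ∑ m ∈ B, scPsi m (T x) with hW
  have hWpos : 0 < W := by
    apply Finset.sum_pos' (fun m _ => scPsi_nonneg _ _)
    refine ⟨fun i => ⌊T x i⌋, ?_, scPsi_floor _⟩
    simp only [B, Fintype.mem_piFinset, Finset.mem_Icc]
    intro q
    have h0 := (hx q.1).1 q.2.1
    have h1 : x q.1 q.2.1 ≤ 1 := by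
      rw [← (hx q.1).2]
      exact Finset.single_le_sum (fun i _ => (hx q.1).1 i) (mem_univ _)
    refine ⟨Int.floor_nonneg.2 (by simp only [T]; positivity), ?_⟩
    have : (⌊T x q⌋ : ℝ) ≤ N + 1 := (Int.floor_le _).trans (by simp only [T]; nlinarith)
    exact_mod_cast this
  let lam : ZMod (k * (n - 1) + 1) → ℝ := fun a =>
    (∑ m ∈ B with color m = a, scPsi m (T x)) / W
  have hlam : ∀ j i, (∑ a, lam a * if I a j = i then 1 else 0) = F x j i / W := by
    intro j i
    simp only [lam, F]
    rw [Finset.sum_div, ← Finset.sum_fiberwise B color]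
    refine Finset.sum_congr rfl fun a _ => ?_
    rw [div_mul_eq_mul_div, Finset.sum_mul, Finset.sum_div]
    refine Finset.sum_congr rfl fun m hm => ?_
    rw [Finset.mem_filter] at hm
    rcases (scPsi_nonneg m (T x)).lt_or_eq with h | h
    · rw [hI a m h hm.2]
    · rw [← h]; simp
  refine ⟨I, x, lam, hx, ⟨fun a => ?_, ?_⟩, ?_, ?_⟩
  · exact div_nonneg (Finset.sum_nonneg fun m _ => scPsi_nonneg _ _) hWpos.le
  · simp only [lam]
    rw [← Finset.sum_div, Finset.sum_fiberwise, ← hW, div_self hWpos.ne']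
  · intro j i i' hpos
    rw [hlam, hlam]
    exact div_le_div_of_nonneg_right (hvi j i i' hpos) hWpos.le
  · intro a ha
    have : ∃ m, 0 < scPsi m (T x) ∧ color m = a := by
      by_contra hno
      push Not at hno
      have : lam a = 0 := by
        simp only [lam]
        rw [Finset.sum_eq_zero, zero_div]
        intro m hm
        rw [Finset.mem_filter] at hm
        by_contra hne
        exact hno m (lt_of_le_of_ne (scPsi_nonneg _ _) (Ne.symm hne)) hm.2
      linarith
    obtain ⟨m, hm, hma⟩ := this
    obtain ⟨hy1, hy2, hy3⟩ := hIY m ⟨x, hx, hm⟩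
    refine ⟨Y m, hy1, ?_, ?_⟩
    · rw [← hI a m hm hma, ← hma]; exact hy3
    · have hclose : ∀ j i, i ≠ z0 → |x j i - Y m j i| ≤ 2 / ((N : ℝ) + 1) := by
        intro j i hi
        have h1 := abs_lt.1 (((scPsi_pos _ _).1 hm).1 (j, ⟨i, hi⟩))
        have h2 := abs_lt.1 (((scPsi_pos _ _).1 hy2).1 (j, ⟨i, hi⟩))
        simp only [T] at h1 h2
        rw [le_div_iff₀ hN, ← abs_of_pos hN, ← abs_mul, abs_le]
        constructor <;> nlinarith
      have hn1 : (1 : ℝ) ≤ n := by exact_mod_cast hn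
      rw [dist_pi_le_iff (by positivity)]
      intro j
      rw [dist_pi_le_iff (by positivity)]
      intro i
      rw [Real.dist_eq]
      have h2N : 0 ≤ 2 / ((N : ℝ) + 1) := by positivity
      rw [mul_div_assoc]
      by_cases hi : i = z0
      · have e1 := Finset.add_sum_erase univ (x j) (mem_univ z0)
        have e2 := Finset.add_sum_erase univ (Y m j) (mem_univ z0)
        rw [(hx j).2] at e1
        rw [(hy1 j).2] at e2
        have e3 : x j z0 - Y m j z0 = -∑ i ∈ univ.erase z0, (x j i - Y m j i) := by
          rw [Finset.sum_sub_distrib]; linarith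
        rw [hi, e3, abs_neg]
        refine (Finset.abs_sum_le_sum_abs _ _).trans ?_
        refine (Finset.sum_le_card_nsmul _ _ (2 / ((N : ℝ) + 1))
          (fun i hi => hclose j i (Finset.ne_of_mem_erase hi))).trans ?_
        rw [nsmul_eq_mul]
        apply mul_le_mul_of_nonneg_right _ h2N
        have := Finset.card_le_univ (univ.erase z0)
        rw [Fintype.card_fin] at this
        exact_mod_cast this
      · refine (hclose j i hi).trans ?_
        nlinarith
theorem sc_limit (n k : ℕ) (hn : 0 < n) (hk : 0 < k)
    (pref : ZMod (k * (n - 1) + 1) → (Fin k → Fin n → ℝ) → (Fin k → Fin n) → Prop)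
    (hexists : ∀ a, ∀ x : Fin k → Fin n → ℝ,
      (∀ j, x j ∈ stdSimplex ℝ (Fin n)) → ∃ I : Fin k → Fin n, pref a x I)
    (hempty : ∀ a (x : Fin k → Fin n → ℝ) (I : Fin k → Fin n),
      (∀ j, x j ∈ stdSimplex ℝ (Fin n)) → pref a x I →
      ∀ j, (∃ i, x j i = 0) → x j (I j) = 0)
    (hclosed : ∀ a (I : Fin k → Fin n),
      IsClosed {x : Fin k → Fin n → ℝ | (∀ j, x j ∈ stdSimplex ℝ (Fin n)) ∧ pref a x I}) :
    ∃ (I : ZMod (k * (n - 1) + 1) → Fin k → Fin n) (x : Fin k → Fin n → ℝ)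
      (lam : ZMod (k * (n - 1) + 1) → ℝ), (∀ j, x j ∈ stdSimplex ℝ (Fin n)) ∧
      lam ∈ stdSimplex ℝ (ZMod (k * (n - 1) + 1)) ∧
      (∀ j i, (∑ a, lam a * if I a j = i then (1 : ℝ) else 0) = 1 / n) ∧
      ∀ a, 0 < lam a → pref a x (I a) := by
  classical
  choose I x lam hx hlam hvi hpr using sc_approx n k hn hk pref hexists
  have hfreq : ∃ I0, ∃ᶠ N in Filter.atTop, I N = I0 := by
    by_contra hno
    push Not at hno
    have := Filter.eventually_all.2 hno
    obtain ⟨N, hN⟩ := this.exists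
    exact hN (I N) rfl
  obtain ⟨I0, hI0⟩ := hfreq
  obtain ⟨φ, hφ, hφI⟩ := Filter.extraction_of_frequently_atTop hI0
  have hK : IsCompact ((Set.univ.pi fun _ : Fin k => stdSimplex ℝ (Fin n)) ×ˢ
      stdSimplex ℝ (ZMod (k * (n - 1) + 1))) :=
    (isCompact_univ_pi fun _ => isCompact_stdSimplex ℝ (Fin n)).prod (isCompact_stdSimplex ℝ _)
  obtain ⟨⟨X, L⟩, hXL, θ, hθ, hlim⟩ := hK.tendsto_subseq
    (x := fun N => (x (φ N), lam (φ N))) (fun N => ⟨fun j _ => hx _ j, hlam _⟩)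
  have hX : ∀ j, X j ∈ stdSimplex ℝ (Fin n) := fun j => hXL.1 j (Set.mem_univ j)
  have hL : L ∈ stdSimplex ℝ (ZMod (k * (n - 1) + 1)) := hXL.2
  have hlX : Filter.Tendsto (fun N => x (φ (θ N))) Filter.atTop (nhds X) :=
    (continuous_fst.tendsto _).comp hlim
  have hlL : Filter.Tendsto (fun N => lam (φ (θ N))) Filter.atTop (nhds L) :=
    (continuous_snd.tendsto _).comp hlim
  have hlXc : ∀ j i, Filter.Tendsto (fun N => x (φ (θ N)) j i) Filter.atTop (nhds (X j i)) :=
    fun j i => tendsto_pi_nhds.1 (tendsto_pi_nhds.1 hlX j) i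
  have hlLc : ∀ a, Filter.Tendsto (fun N => lam (φ (θ N)) a) Filter.atTop (nhds (L a)) :=
    fun a => tendsto_pi_nhds.1 hlL a
  have hVI : ∀ j i i', 0 < X j i → (∑ a, L a * if I0 a j = i' then (1 : ℝ) else 0) ≤
        ∑ a, L a * if I0 a j = i then (1 : ℝ) else 0 := by
    intro j i i' hpos
    refine le_of_tendsto_of_tendsto
      (tendsto_finsetSum _ fun a _ => (hlLc a).mul_const _)
      (tendsto_finsetSum _ fun a _ => (hlLc a).mul_const _) ?_
    filter_upwards [(hlXc j i).eventually (lt_mem_nhds hpos)] with N hN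
    have := hvi (φ (θ N)) j i i' hN
    rw [hφI] at this
    exact this
  have hpref : ∀ a, 0 < L a → pref a X (I0 a) := by
    intro a ha
    suffices h : X ∈ {x : Fin k → Fin n → ℝ | (∀ j, x j ∈ stdSimplex ℝ (Fin n)) ∧ pref a x (I0 a)} from h.2
    rw [← (hclosed a (I0 a)).closure_eq, Metric.mem_closure_iff]
    intro ε hε
    have he : Filter.Tendsto (fun N : ℕ => ((n : ℝ) * 2) / ((N : ℝ) + 1)) Filter.atTop (nhds 0) := by
      have := (tendsto_one_div_add_atTop_nhds_zero_nat (𝕜 := ℝ)).const_mul ((n : ℝ) * 2)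
      simpa [div_eq_mul_inv] using this
    have he' := he.comp (hφ.comp hθ).tendsto_atTop
    have e1 := (hlLc a).eventually (lt_mem_nhds ha)
    have e2 := he'.eventually (gt_mem_nhds (show (0 : ℝ) < ε / 2 by positivity))
    have e3 := (Metric.tendsto_nhds.1 hlX) (ε / 2) (by positivity)
    obtain ⟨N, h1, h2, h3⟩ := (e1.and (e2.and e3)).exists
    simp only [Function.comp] at h2 h3
    obtain ⟨y, hy1, hy2, hy3⟩ := hpr _ a h1
    rw [hφI] at hy2
    refine ⟨y, ⟨hy1, hy2⟩, ?_⟩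
    have := dist_triangle X (x (φ (θ N))) y
    rw [dist_comm X (x (φ (θ N)))] at this
    linarith
  refine ⟨I0, X, L, hX, hL, ?_, hpref⟩
  intro j
  have htot : ∑ i, (∑ a, L a * if I0 a j = i then (1 : ℝ) else 0) = 1 := by
    rw [Finset.sum_comm]
    refine Eq.trans (Finset.sum_congr rfl fun a _ => ?_) hL.2
    rw [← Finset.mul_sum]; simp
  have hpos : ∀ i, 0 < X j i := by
    by_contra hno
    push Not at hno
    obtain ⟨i1, hi1⟩ := hno
    have hz : ∃ i, X j i = 0 := ⟨i1, le_antisymm hi1 ((hX j).1 i1)⟩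
    have hp : ∃ i, 0 < X j i := by
      by_contra hno
      push Not at hno
      have := Finset.sum_nonpos (s := univ) fun i _ => hno i
      rw [(hX j).2] at this
      linarith
    obtain ⟨i, hi⟩ := hp
    have h0 : (∑ a, L a * if I0 a j = i then (1 : ℝ) else 0) = 0 := by
      refine Finset.sum_eq_zero fun a _ => ?_
      rcases (hL.1 a).lt_or_eq with h | h
      · have := hempty a X (I0 a) hX (hpref a h) j hz
        rw [if_neg, mul_zero]
        rintro rfl
        linarith
      · rw [← h, zero_mul]
    have h1 := Finset.sum_nonpos (s := univ) fun i' _ => (hVI j i i' hi).trans h0.le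
    rw [htot] at h1
    linarith
  intro i
  have heq : ∀ i', (∑ a, L a * if I0 a j = i' then (1 : ℝ) else 0) =
      ∑ a, L a * if I0 a j = i then (1 : ℝ) else 0 :=
    fun i' => le_antisymm (hVI j i i' (hpos i)) (hVI j i' i (hpos i'))
  rw [Finset.sum_congr rfl fun i' _ => heq i'] at htot
  rw [Finset.sum_const, Finset.card_univ, Fintype.card_fin, nsmul_eq_mul] at htot
  have : (n : ℝ) ≠ 0 := by positivity
  field_simp
  linarith

theorem sc_greedy {A : Type*} [Fintype A] [DecidableEq A] (n k : ℕ) (hn : 0 < n)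
    (I : A → Fin k → Fin n) (lam : A → ℝ) (hlam : lam ∈ stdSimplex ℝ A)
    (hsum : ∀ j i, (∑ a, lam a * if I a j = i then (1 : ℝ) else 0) = 1 / n) (r : ℕ) :
    ∀ U : Finset (Fin k × Fin n),
      (∀ a, 0 < lam a → (U.filter fun e => I a e.1 = e.2).card ≤ r + 1) →
      ∃ S : Finset A, (∀ a ∈ S, 0 < lam a) ∧ (∀ e ∈ U, ∃ a ∈ S, I a e.1 = e.2) ∧
        (S.card : ℝ) ≤ (U.card : ℝ) / ((r + 1 : ℕ) : ℝ) + n * ((harmonic (r + 1) : ℚ) - 1 : ℝ) := by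
  have hnR : (0 : ℝ) < n := by exact_mod_cast hn
  induction r with
  | zero =>
    intro U
    induction U using Finset.strongInduction with
    | H U ihU =>
    intro hU
    by_cases hUe : U = ∅
    · subst hUe
      exact ⟨∅, by simp, by simp, by simp [harmonic]⟩
    obtain ⟨e, he⟩ := Finset.nonempty_iff_ne_empty.2 hUe
    have hex : ∃ a, 0 < lam a ∧ I a e.1 = e.2 := by
      by_contra hno
      push Not at hno
      have h0 := hsum e.1 e.2
      rw [Finset.sum_eq_zero] at h0
      · have : (0 : ℝ) < 1 / n := by positivity
        linarith
      · intro a _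
        rcases (hlam.1 a).lt_or_eq with h | h
        · rw [if_neg (hno a h), mul_zero]
        · rw [← h, zero_mul]
    obtain ⟨a, ha, hae⟩ := hex
    have hss : U.filter (fun e => ¬ I a e.1 = e.2) ⊂ U :=
      Finset.filter_ssubset.2 ⟨e, he, by simpa using hae⟩
    obtain ⟨S, hS1, hS2, hS3⟩ := ihU _ hss (fun b hb =>
      (Finset.card_le_card (Finset.filter_subset_filter _ hss.1)).trans (hU b hb))
    refine ⟨insert a S, ?_, ?_, ?_⟩
    · intro b hb
      rcases Finset.mem_insert.1 hb with rfl | hb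
      · exact ha
      · exact hS1 b hb
    · intro f hf
      by_cases hfa : I a f.1 = f.2
      · exact ⟨a, by simp, hfa⟩
      · obtain ⟨b, hb, hbf⟩ := hS2 f (by simp [hf, hfa])
        exact ⟨b, by simp [hb], hbf⟩
    · have h1 : ((insert a S).card : ℝ) ≤ S.card + 1 := by exact_mod_cast Finset.card_insert_le a S
      have h2 : ((U.filter (fun e => ¬ I a e.1 = e.2)).card : ℝ) + 1 ≤ U.card := by
        exact_mod_cast Finset.card_lt_card hss
      simp only [zero_add, Nat.cast_one, div_one] at hS3 ⊢
      linarith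
  | succ r ihr =>
    intro U
    induction U using Finset.strongInduction with
    | H U ihU =>
    intro hU
    by_cases hex : ∃ a, 0 < lam a ∧ (U.filter fun e => I a e.1 = e.2).card = r + 1 + 1
    · obtain ⟨a, ha, hac⟩ := hex
      have hcards := Finset.card_filter_add_card_filter_not (s := U) (fun e => I a e.1 = e.2)
      have hss : U.filter (fun e => ¬ I a e.1 = e.2) ⊂ U := by
        refine lt_of_le_of_ne (Finset.filter_subset _ _) fun h => ?_
        rw [h] at hcards; omega
      obtain ⟨S, hS1, hS2, hS3⟩ := ihU _ hss (fun b hb =>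
        (Finset.card_le_card (Finset.filter_subset_filter _ hss.1)).trans (hU b hb))
      refine ⟨insert a S, ?_, ?_, ?_⟩
      · intro b hb
        rcases Finset.mem_insert.1 hb with rfl | hb
        · exact ha
        · exact hS1 b hb
      · intro f hf
        by_cases hfa : I a f.1 = f.2
        · exact ⟨a, by simp, hfa⟩
        · obtain ⟨b, hb, hbf⟩ := hS2 f (by simp [hf, hfa])
          exact ⟨b, by simp [hb], hbf⟩
      · have h1 : ((insert a S).card : ℝ) ≤ S.card + 1 := by exact_mod_cast Finset.card_insert_le a S
        have h2 : (U.card : ℝ) = ((r + 1 + 1 : ℕ) : ℝ) +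
            ((U.filter (fun e => ¬ I a e.1 = e.2)).card : ℝ) := by
          rw [hac] at hcards
          exact_mod_cast hcards.symm
        have h3 : ((r + 1 + 1 : ℕ) : ℝ) ≠ 0 := by positivity
        rw [h2, add_div, div_self h3]
        linarith
    · push Not at hex
      have hle : ∀ a, 0 < lam a → (U.filter fun e => I a e.1 = e.2).card ≤ r + 1 := by
        intro a ha
        have := hU a ha
        have := hex a ha
        omega
      obtain ⟨S, hS1, hS2, hS3⟩ := ihr U hle
      refine ⟨S, hS1, hS2, hS3.trans ?_⟩
      have hUc : (U.card : ℝ) ≤ n * ((r + 1 : ℕ) : ℝ) := by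
        have e1 : (U.card : ℝ) / n = ∑ e ∈ U, ∑ a, lam a * if I a e.1 = e.2 then (1 : ℝ) else 0 := by
          rw [Finset.sum_congr rfl fun e _ => hsum e.1 e.2, Finset.sum_const, nsmul_eq_mul]
          ring
        rw [Finset.sum_comm] at e1
        have e2 : (U.card : ℝ) / n ≤ ∑ a, lam a * ((r + 1 : ℕ) : ℝ) := by
          rw [e1]
          refine Finset.sum_le_sum fun a _ => ?_
          rw [← Finset.mul_sum, Finset.sum_boole]
          rcases (hlam.1 a).lt_or_eq with h | h
          · exact mul_le_mul_of_nonneg_left (by exact_mod_cast hle a h) h.le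
          · rw [← h]; simp
        rw [← Finset.sum_mul, hlam.2, one_mul, div_le_iff₀ hnR] at e2
        linarith
      rw [harmonic_succ (r + 1)]
      push_cast at hUc ⊢
      have h1 : (0 : ℝ) < (r : ℝ) + 1 := by positivity
      have h2 : (0 : ℝ) < (r : ℝ) + 1 + 1 := by positivity
      have h3 : (U.card : ℝ) / (r + 1) ≤ (U.card : ℝ) / (r + 1 + 1) + n * ((r : ℝ) + 1 + 1)⁻¹ := by
        rw [← div_eq_mul_inv, ← add_div, div_le_div_iff₀ h1 h2]
        nlinarith
      linarith

theorem sc_two {A : Type*} [Fintype A] [DecidableEq A] (n : ℕ) (hn : 0 < n)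
    (I : A → Fin 2 → Fin n) (lam : A → ℝ) (hlam : lam ∈ stdSimplex ℝ A)
    (hsum : ∀ j i, (∑ a, lam a * if I a j = i then (1 : ℝ) else 0) = 1 / n) :
    ∃ S : Finset A, (∀ a ∈ S, 0 < lam a) ∧ (∀ j i, ∃ a ∈ S, I a j = i) ∧ S.card ≤ n := by
  classical
  have hnR : (0 : ℝ) < n := by exact_mod_cast hn
  let t : Fin n → Finset (Fin n) := fun i =>
    (univ.filter fun a => 0 < lam a ∧ I a 0 = i).image fun a => I a 1
  have hS : ∀ (j : Fin 2) (s : Finset (Fin n)),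
      (s.card : ℝ) / n = ∑ a, lam a * if I a j ∈ s then (1 : ℝ) else 0 := by
    intro j s
    have e1 : (s.card : ℝ) / n = ∑ i ∈ s, ∑ a, lam a * if I a j = i then (1 : ℝ) else 0 := by
      rw [Finset.sum_congr rfl fun i _ => hsum j i, Finset.sum_const, nsmul_eq_mul]
      ring
    rw [e1, Finset.sum_comm]
    refine Finset.sum_congr rfl fun a _ => ?_
    rw [← Finset.mul_sum, Finset.sum_ite_eq]
  have hhall : ∀ s : Finset (Fin n), s.card ≤ (s.biUnion t).card := by
    intro s
    have : (s.card : ℝ) / n ≤ ((s.biUnion t).card : ℝ) / n := by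
      rw [hS 0, hS 1]
      refine Finset.sum_le_sum fun a _ => ?_
      rcases (hlam.1 a).lt_or_eq with h | h
      · apply mul_le_mul_of_nonneg_left _ h.le
        by_cases hs : I a 0 ∈ s
        · rw [if_pos hs, if_pos]
          simp only [Finset.mem_biUnion, t, Finset.mem_image, Finset.mem_filter, mem_univ, true_and]
          exact ⟨_, hs, a, ⟨h, rfl⟩, rfl⟩
        · rw [if_neg hs]; split_ifs <;> norm_num
      · rw [← h]; simp
    rw [div_le_div_iff_of_pos_right hnR] at this
    exact_mod_cast this
  obtain ⟨f, hf, hft⟩ := (Finset.all_card_le_biUnion_card_iff_exists_injective t).1 hhall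
  simp only [t, Finset.mem_image, Finset.mem_filter, mem_univ, true_and] at hft
  choose g hg using hft
  refine ⟨univ.image g, ?_, ?_, ?_⟩
  · intro a ha
    obtain ⟨i, -, rfl⟩ := Finset.mem_image.1 ha
    exact (hg i).1.1
  · intro j i
    fin_cases j
    · exact ⟨g i, by simp, (hg i).1.2⟩
    · obtain ⟨i', rfl⟩ := (Finite.injective_iff_surjective.1 hf) i
      exact ⟨g i', by simp, (hg i').2⟩
  · exact Finset.card_image_le.trans (by simp)


/-- **Covering shifts with few employees.**  A partition of `k` days into `n` shifts each is a
point of `P(n,k) = (Δ_{n-1})^k`, encoded as `x : Fin k → Fin n → ℝ` with each `x j` in the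
standard simplex.  A `k`-shift selection is `I : Fin k → Fin n` (one shift per day);
`pref a x I` means that employee `a` finds the selection `I` acceptable at partition `x`.
There are `p ≥ k(n-1)+1` employees, each of whom always prefers at least one selection,
takes an empty shift whenever one is available on a day, and has closed preference sets.
Then there is a partition of the `k` days for which a subset of at most `n(1 + ln k)`
employees covers all `kn` shifts (for each day `j` and shift `i` some chosen employee has `i`
as the `j`-th coordinate of a preferred selection); moreover if `k = 2` then `n` employees
suffice. -/
theorem shift_covering (n k p : ℕ) (hn : 0 < n) (hk : 0 < k)
    (hp : k * (n - 1) + 1 ≤ p)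
    (pref : Fin p → (Fin k → Fin n → ℝ) → (Fin k → Fin n) → Prop)
    (hexists : ∀ a : Fin p, ∀ x : Fin k → Fin n → ℝ,
      (∀ j, x j ∈ stdSimplex ℝ (Fin n)) → ∃ I : Fin k → Fin n, pref a x I)
    (hempty : ∀ (a : Fin p) (x : Fin k → Fin n → ℝ) (I : Fin k → Fin n),
      (∀ j, x j ∈ stdSimplex ℝ (Fin n)) → pref a x I →
      ∀ j, (∃ i, x j i = 0) → x j (I j) = 0)
    (hclosed : ∀ (a : Fin p) (I : Fin k → Fin n),
      IsClosed {x : Fin k → Fin n → ℝ | (∀ j, x j ∈ stdSimplex ℝ (Fin n)) ∧ pref a x I}) :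
    (∃ x : Fin k → Fin n → ℝ, (∀ j, x j ∈ stdSimplex ℝ (Fin n)) ∧
      ∃ (A : Finset (Fin p)) (sel : Fin p → Fin k → Fin n),
        (A.card : ℝ) ≤ n * (1 + Real.log k) ∧
        (∀ a ∈ A, pref a x (sel a)) ∧
        ∀ (j : Fin k) (i : Fin n), ∃ a ∈ A, sel a j = i) ∧
    (k = 2 → ∃ x : Fin k → Fin n → ℝ, (∀ j, x j ∈ stdSimplex ℝ (Fin n)) ∧
      ∃ (A : Finset (Fin p)) (sel : Fin p → Fin k → Fin n),
        A.card ≤ n ∧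
        (∀ a ∈ A, pref a x (sel a)) ∧
        ∀ (j : Fin k) (i : Fin n), ∃ a ∈ A, sel a j = i) := by

  classical
  let emb : ZMod (k * (n - 1) + 1) → Fin p :=
    fun a => Fin.castLE hp (show Fin (k * (n - 1) + 1) from a)
  have hemb : Function.Injective emb := fun a b h => Fin.castLE_injective hp h
  obtain ⟨I, x, lam, hx, hlam, hsum, hpr⟩ := sc_limit n k hn hk (fun a => pref (emb a))
    (fun a => hexists (emb a)) (fun a => hempty (emb a)) (fun a => hclosed (emb a))
  have hfin : ∀ S : Finset (ZMod (k * (n - 1) + 1)), (∀ a ∈ S, 0 < lam a) →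
      (∀ j i, ∃ a ∈ S, I a j = i) →
      ∃ (A : Finset (Fin p)) (sel : Fin p → Fin k → Fin n), A.card = S.card ∧
        (∀ a ∈ A, pref a x (sel a)) ∧
        ∀ (j : Fin k) (i : Fin n), ∃ a ∈ A, sel a j = i := by
    intro S h1 h2
    refine ⟨S.image emb, Function.extend emb I (fun _ _ => ⟨0, hn⟩),
      Finset.card_image_of_injective _ hemb, ?_, ?_⟩
    · intro b hb
      obtain ⟨a, ha, rfl⟩ := Finset.mem_image.1 hb
      rw [hemb.extend_apply]
      exact hpr a (h1 a ha)
    · intro j i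
      obtain ⟨a, ha, hai⟩ := h2 j i
      exact ⟨emb a, Finset.mem_image_of_mem _ ha, by rw [hemb.extend_apply]; exact hai⟩
  constructor
  · obtain ⟨r, rfl⟩ : ∃ r, k = r + 1 := ⟨k - 1, by omega⟩
    obtain ⟨S, hS1, hS2, hS3⟩ := sc_greedy n (r + 1) hn I lam hlam hsum r univ (by
      intro a _
      have : (univ.filter fun e : Fin (r + 1) × Fin n => I a e.1 = e.2).card ≤
          (univ : Finset (Fin (r + 1))).card := by
        apply Finset.card_le_card_of_injOn Prod.fst (fun _ _ => by simp)
        intro e he f hf hef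
        simp only [coe_filter, mem_univ, true_and, Set.mem_ofPred_eq] at he hf
        exact Prod.ext hef (by rw [← he, ← hf, hef])
      simpa using this)
    obtain ⟨A, sel, hA, hA2, hA3⟩ := hfin S hS1 (fun j i => hS2 (j, i) (mem_univ _))
    refine ⟨x, hx, A, sel, ?_, hA2, hA3⟩
    rw [hA]
    refine hS3.trans ?_
    have hh := harmonic_le_one_add_log (r + 1)
    have hc : ((univ : Finset (Fin (r + 1) × Fin n)).card : ℝ) / ((r + 1 : ℕ) : ℝ) = n := by
      rw [Finset.card_univ, Fintype.card_prod, Fintype.card_fin, Fintype.card_fin, Nat.cast_mul,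
        mul_div_assoc, mul_div_cancel₀]
      positivity
    rw [hc]
    have hnR : (0 : ℝ) ≤ n := by positivity
    nlinarith
  · intro hk2
    subst hk2
    obtain ⟨S, hS1, hS2, hS3⟩ := sc_two n hn I lam hlam hsum
    obtain ⟨A, sel, hA, hA2, hA3⟩ := hfin S hS1 hS2
    exact ⟨x, hx, A, sel, hA ▸ hS3, hA2, hA3⟩
end
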